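/- Let i ≥ 2 be such that #f_{i−1} = #f_i = #f_{i+1} = 1, write f_i = {d}, and let J be an invariant-factor count function for d. Then there is a constant C depending only on d such that for all integers n ≥ 3, |(1/n)·Σ_{m=1}^n J(m) − μ_i·log log n| ≤ C. -/

import Mathlib

open MeasureTheory ProbabilityTheory Filter

noncomputable section

/-- A key encoding the lexicographic order on pairs `(φ(q), q)`; this is a valid
encoding on prime powers since every prime power satisfies `q ≤ 2 * φ(q)`. -/
def ppKey (q : ℕ) : ℕ := 2 * Nat.totient q ^ 2 + q

/-- The `n`-th smallest key of a prime power (0-indexed). -/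
def ppNthKey (n : ℕ) : ℕ := Nat.nth (fun k => ∃ q : ℕ, IsPrimePow q ∧ ppKey q = k) n

/-- The total φ-sequence `q̃_i` (1-indexed): the enumeration of all prime powers
ordered by nondecreasing totient, with ties broken by increasing size. -/
def qt (i : ℕ) : ℕ := sInf {q : ℕ | IsPrimePow q ∧ ppKey q = ppNthKey (i - 1)}

/-- `lcm(q̃_1, …, q̃_i)`. -/
def Lseq (i : ℕ) : ℕ := (Finset.Icc 1 i).lcm qt

/-- The universal factor order set `f_i`. -/
def UFO (i : ℕ) : Set ℕ :=
  if Nat.totient (qt i) < Nat.totient (qt (i + 1)) then {Lseq i}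
  else {Lseq i, Nat.lcm (Lseq (i - 1)) (qt (i + 1))}

/-- `φ(q̃_i)` as a real number. -/
def phiQ (i : ℕ) : ℝ := (Nat.totient (qt i) : ℝ)

/-- `μ_i = 1/φ(q̃_i) − 1/φ(q̃_{i+1})`. -/
def muSeq (i : ℕ) : ℝ := 1 / phiQ i - 1 / phiQ (i + 1)

/-- `σ_i = (1/φ(q̃_i) + 1/φ(q̃_{i+1}) − 2/(φ(q̃_i)·φ(q̃_{i+1})))^{1/2}`. -/
def sigSeq (i : ℕ) : ℝ :=
  Real.sqrt (1 / phiQ i + 1 / phiQ (i + 1) - 2 / (phiQ i * phiQ (i + 1)))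

/-- `σ_{i;a,b} = (φ(q̃_i)^{−a} + φ(q̃_{i+1})^{−b} − 2/(φ(q̃_i)·φ(q̃_{i+1})))^{1/2}`. -/
def sigAB (i a b : ℕ) : ℝ :=
  Real.sqrt (1 / phiQ i ^ a + 1 / phiQ (i + 1) ^ b - 2 / (phiQ i * phiQ (i + 1)))

/-- `ν_j = (φ(q̃_j)^{−1}·(1 − φ(q̃_j)^{−1}))^{1/2}`. -/
def nuSeq (j : ℕ) : ℝ := Real.sqrt (1 / phiQ j * (1 - 1 / phiQ j))

/-- `J` is an invariant-factor count function for `d`: whenever `(ℤ/mℤ)ˣ` is isomorphic to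
a direct product of cyclic groups `ℤ/λ_1 × ⋯ × ℤ/λ_K` with `1 < λ_1 ∣ λ_2 ∣ ⋯ ∣ λ_K`,
`J m` is the number of indices `j` with `λ_j = d`. -/
def IsInvCount (d : ℕ) (J : ℕ → ℕ) : Prop :=
  ∀ m : ℕ, 1 ≤ m → ∀ K : ℕ, ∀ lam : Fin K → ℕ,
    (∀ j, 1 < lam j) →
    (∀ j k : Fin K, j ≤ k → lam j ∣ lam k) →
    Nonempty ((ZMod m)ˣ ≃* Multiplicative (∀ j : Fin K, ZMod (lam j))) →
    J m = (Finset.univ.filter fun j : Fin K => lam j = d).card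

/-- The number of `m ∈ {1, …, n}` satisfying `P`. -/
def cnt (P : ℕ → Prop) (n : ℕ) : ℕ := {m : ℕ | 1 ≤ m ∧ m ≤ n ∧ P m}.ncard

/-- The average `(1/n)·∑_{m=1}^n J(m)`. -/
def avg (J : ℕ → ℕ) (n : ℕ) : ℝ := (∑ m ∈ Finset.Icc 1 n, (J m : ℝ)) / n

/-- `log log n`. -/
def LL (n : ℕ) : ℝ := Real.log (Real.log n)

/-- The standard normal cumulative distribution function. -/
def Phi (x : ℝ) : ℝ := (Real.sqrt (2 * Real.pi))⁻¹ * ∫ t in Set.Iic x, Real.exp (-t ^ 2 / 2)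

/-- Owen's T-function. -/
def OwenT (h a : ℝ) : ℝ :=
  (2 * Real.pi)⁻¹ * ∫ t in (0:ℝ)..a, Real.exp (-(1 + t ^ 2) * h ^ 2 / 2) / (1 + t ^ 2)

/-- The skew-normal cumulative distribution function with parameter `α`. -/
def PhiSkew (x α : ℝ) : ℝ := Phi x - 2 * OwenT x α

/-- The standard Gaussian probability measure `γ^k` on `ℝ^k`. -/
def stdGaussian (k : ℕ) : Measure (Fin k → ℝ) :=
  Measure.pi fun _ => gaussianReal 0 1

/-- `ω(m;q,1)`: the number of distinct primes `p ∣ m` with `p ≡ 1 (mod q)`. -/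
def omegaQ (m q : ℕ) : ℕ := (m.primeFactors.filter fun p => p % q = 1 % q).card

/-- The correction term `Ē(m;p^α)`. -/
def Ebar (m p α : ℕ) : ℕ :=
  if p ^ α = 2 ∧ 8 ∣ m then 2
  else if p ^ α = 2 ∧ 4 ∣ m ∧ ¬(8 ∣ m) then 1
  else if p = 2 ∧ 2 ≤ α ∧ 2 ^ (α + 2) ∣ m then 1
  else if p ≠ 2 ∧ p ^ (α + 1) ∣ m then 1
  else 0

/-- `prm(m;q)` for a prime power `q = p^α`: the unique `k` such that `p^k` is the cardinality
of the subgroup `{x ∈ (ℤ/mℤ)ˣ : x^p = 1 and x = y^{p^{α−1}} for some y}` (obtained here as the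
`p`-adic valuation of that cardinality; note `p = q.minFac` and `p^{α−1} = q / p`). -/
def prm (m q : ℕ) : ℕ :=
  (Nat.card {x : (ZMod m)ˣ // x ^ q.minFac = 1 ∧ ∃ y : (ZMod m)ˣ, y ^ (q / q.minFac) = x}).factorization
    q.minFac

/-- `m` is `y`-typical: for all prime powers `q₁, q₂` with `φ(q₁) ≤ y` and `φ(q₁) < φ(q₂)`
one has `prm(m;q₁) > prm(m;q₂)`. -/
def yTypical (y : ℝ) (m : ℕ) : Prop :=
  ∀ q₁ q₂ : ℕ, IsPrimePow q₁ → IsPrimePow q₂ →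
    (Nat.totient q₁ : ℝ) ≤ y → Nat.totient q₁ < Nat.totient q₂ →
    prm m q₂ < prm m q₁

/-- The primes `r ≤ n` with `r ≡ 1 (mod q)`. -/
def apPrimes (q n : ℕ) : Finset ℕ :=
  (Finset.range (n + 1)).filter fun r => r.Prime ∧ r ≡ 1 [MOD q]

/-- The sum of `1 / r` over primes `r ≤ n` with `r ≡ 1 (mod q)`. -/
def recipSum (q n : ℕ) : ℝ := ∑ r ∈ apPrimes q n, (r : ℝ)⁻¹

section MertensAP

open ArithmeticFunction ArithmeticFunction.vonMangoldt
open Complex hiding exp log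
open scoped LSeries.notation

variable {q : ℕ} {a : ZMod q}

lemma residueClass_summable (a : ZMod q) {x : ℝ} (hx : 1 < x) :
    Summable fun n : ℕ => residueClass a n / (n : ℝ) ^ x := by
  have h : LSeriesSummable ↗(residueClass a) x :=
    LSeriesSummable_of_abscissaOfAbsConv_lt_re <|
      (abscissaOfAbsConv_residueClass_le_one a).trans_lt <| by norm_cast
  have h' := h.norm
  refine h'.congr fun n => ?_
  rcases eq_or_ne n 0 with rfl | hn
  · simp
  · rw [LSeries.term_of_ne_zero hn, norm_div, Complex.norm_real,
      Complex.norm_natCast_cpow_of_pos (Nat.pos_of_ne_zero hn), Complex.ofReal_re,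
      Real.norm_of_nonneg (residueClass_nonneg a n)]

lemma residueClass_tsum_eq [NeZero q] (ha : IsUnit a) :
    ∃ h : ℝ → ℝ, ContinuousOn h (Set.Icc 1 2) ∧ ∀ x : ℝ, 1 < x →
      ∑' n, residueClass a n / (n : ℝ) ^ x = h x + (q.totient : ℝ)⁻¹ / (x - 1) := by
  refine ⟨fun x : ℝ ↦ (LFunctionResidueClassAux a x).re, ?_, fun x hx => ?_⟩
  · exact continuous_re.continuousOn.comp (t := Set.univ) (continuousOn_LFunctionResidueClassAux a)
      (fun ⦃x⦄ a ↦ trivial) |>.comp continuous_ofReal.continuousOn fun x hx ↦ by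
        simpa only [Set.mem_ofPred_eq, ofReal_re] using hx.1
  · refine ofReal_injective ?_
    simp only [ofReal_tsum, ofReal_div, ofReal_cpow (Nat.cast_nonneg _), ofReal_natCast,
      ofReal_add, ofReal_inv, ofReal_sub, ofReal_one]
    simp_rw [← LFunctionResidueClassAux_real ha hx,
      eqOn_LFunctionResidueClassAux ha <| Set.mem_ofPred.mpr (ofReal_re x ▸ hx), sub_add_cancel,
      LSeries, LSeries.term]
    refine tsum_congr fun n ↦ ?_
    split_ifs with hn
    · simp only [hn, residueClass_apply_zero, ofReal_zero, zero_div]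
    · rfl

lemma integral_inv_rpow {k : ℕ} (hk : 2 ≤ k) (x : ℝ) :
    ∫ t in x..2, ((k : ℝ) ^ t)⁻¹ = (((k : ℝ) ^ x)⁻¹ - ((k : ℝ) ^ (2 : ℝ))⁻¹) / Real.log k := by
  have hk0 : (0 : ℝ) < k := by positivity
  have hlog : 0 < Real.log k := Real.log_pos (by exact_mod_cast hk)
  have hd : ∀ t ∈ Set.uIcc x 2,
      HasDerivAt (fun t : ℝ => -((k : ℝ) ^ (-t)) / Real.log k) (((k : ℝ) ^ t)⁻¹) t := by
    intro t _
    have h1 := ((hasDerivAt_id t).neg.const_rpow (a := (k : ℝ)) hk0).neg.div_const (Real.log k)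
    convert! h1 using 1
    rw [Pi.neg_apply, id, Real.rpow_neg hk0.le]
    field_simp
  have hc : Continuous fun t : ℝ => ((k : ℝ) ^ t)⁻¹ := by
    refine (Continuous.rpow continuous_const continuous_id fun t => Or.inl hk0.ne').inv₀ fun t => ?_
    positivity
  rw [intervalIntegral.integral_eq_sub_of_hasDerivAt hd (hc.intervalIntegrable _ _),
    Real.rpow_neg hk0.le, Real.rpow_neg hk0.le]
  field_simp
  ring

lemma residueClass_eq_zero_of_lt_two (a : ZMod q) {k : ℕ} (hk : ¬ 2 ≤ k) :
    residueClass a k = 0 := by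
  have h : k = 0 ∨ k = 1 := by omega
  refine le_antisymm ((residueClass_le a k).trans ?_) (residueClass_nonneg a k)
  rcases h with rfl | rfl <;> simp

lemma hasSum_residueClass_log (a : ZMod q) {x : ℝ} (hx : 1 < x) (hx2 : x ≤ 2) :
    HasSum (fun k : ℕ => residueClass a k / Real.log k *
        (((k : ℝ) ^ x)⁻¹ - ((k : ℝ) ^ (2 : ℝ))⁻¹))
      (∫ t in x..2, ∑' n, residueClass a n / (n : ℝ) ^ t) := by
  have key := intervalIntegral.hasSum_integral_of_dominated_convergence (μ := volume)
    (F := fun (k : ℕ) (t : ℝ) => residueClass a k / (k : ℝ) ^ t)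
    (f := fun t : ℝ => ∑' n, residueClass a n / (n : ℝ) ^ t) (a := x) (b := 2)
    (fun (k : ℕ) (_ : ℝ) => residueClass a k / (k : ℝ) ^ x) ?_ ?_ ?_ ?_ ?_
  · convert! key using 1
    ext k
    by_cases hk : 2 ≤ k
    · simp_rw [div_eq_mul_inv (residueClass a k)]
      rw [intervalIntegral.integral_const_mul, integral_inv_rpow hk]
      ring
    · simp [residueClass_eq_zero_of_lt_two a hk]
  · intro k
    by_cases hk : 2 ≤ k
    · have hk0 : (0 : ℝ) < k := by positivity
      have hc : Continuous fun t : ℝ => residueClass a k / (k : ℝ) ^ t := by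
        refine continuous_const.div
          (Continuous.rpow continuous_const continuous_id fun t => Or.inl hk0.ne') fun t => ?_
        positivity
      exact hc.aestronglyMeasurable
    · simp [residueClass_eq_zero_of_lt_two a hk, aestronglyMeasurable_const]
  · intro k
    refine Eventually.of_forall fun t ht => ?_
    rw [Set.uIoc_of_le hx2] at ht
    by_cases hk : 2 ≤ k
    · rw [Real.norm_of_nonneg (div_nonneg (residueClass_nonneg a k) (by positivity))]
      refine div_le_div_of_nonneg_left (residueClass_nonneg a k) (by positivity) ?_
      exact Real.rpow_le_rpow_of_exponent_le (by exact_mod_cast (by omega : 1 ≤ k)) ht.1.le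
    · simp [residueClass_eq_zero_of_lt_two a hk]
  · exact Eventually.of_forall fun t _ => residueClass_summable a hx
  · exact intervalIntegrable_const
  · refine Eventually.of_forall fun t ht => ?_
    rw [Set.uIoc_of_le hx2] at ht
    exact (residueClass_summable a (hx.trans ht.1)).hasSum

/-- Integrated form of the pole of the residue class Dirichlet series at `1`. -/
lemma integral_residueClass_bound [NeZero q] (ha : IsUnit a) :
    ∃ C : ℝ, 0 ≤ C ∧ ∀ x : ℝ, 1 < x → x ≤ 2 →
      (∑' n, residueClass a n / (n : ℝ) ^ x ≤ (x - 1)⁻¹ + C) ∧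
      |(∫ t in x..2, ∑' n, residueClass a n / (n : ℝ) ^ t) -
        (q.totient : ℝ)⁻¹ * Real.log (x - 1)⁻¹| ≤ C := by
  obtain ⟨h, hc, hh⟩ := residueClass_tsum_eq ha
  obtain ⟨C, hC⟩ := isCompact_Icc.exists_bound_of_continuousOn hc
  have hC0 : 0 ≤ C := (norm_nonneg _).trans (hC 1 (by norm_num))
  refine ⟨C, hC0, fun x hx hx2 => ⟨?_, ?_⟩⟩
  · rw [hh x hx, add_comm, div_eq_mul_inv]
    have h1 : (q.totient : ℝ)⁻¹ ≤ 1 :=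
      inv_le_one_of_one_le₀ (by exact_mod_cast Nat.totient_pos.mpr q.pos_of_neZero)
    have h2 : 0 < (x - 1)⁻¹ := by
      have : 0 < x - 1 := by linarith
      positivity
    have h3 := (le_abs_self _).trans (hC x ⟨hx.le, hx2⟩)
    nlinarith
  · have hcong : Set.EqOn (fun t : ℝ => ∑' n, residueClass a n / (n : ℝ) ^ t)
        (fun t => h t + (q.totient : ℝ)⁻¹ * (t - 1)⁻¹) (Set.uIcc x 2) := by
      intro t ht
      rw [Set.uIcc_of_le hx2] at ht
      simp only
      rw [hh t (hx.trans_le ht.1), div_eq_mul_inv]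
    have hsub : Set.uIcc x 2 ⊆ Set.Icc 1 2 := by
      rw [Set.uIcc_of_le hx2]
      exact Set.Icc_subset_Icc_left hx.le
    have hi1 : IntervalIntegrable h volume x 2 := (hc.mono hsub).intervalIntegrable
    have hi2 : IntervalIntegrable (fun t : ℝ => (q.totient : ℝ)⁻¹ * (t - 1)⁻¹) volume x 2 := by
      refine ContinuousOn.intervalIntegrable ?_
      refine continuousOn_const.mul (ContinuousOn.inv₀ (by fun_prop) fun t ht => ?_)
      rw [Set.uIcc_of_le hx2] at ht
      have := ht.1
      intro h0
      linarith
    rw [intervalIntegral.integral_congr hcong, intervalIntegral.integral_add hi1 hi2,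
      intervalIntegral.integral_const_mul,
      intervalIntegral.integral_comp_sub_right (fun t : ℝ => t⁻¹) 1,
      integral_inv_of_pos (by linarith) (by norm_num)]
    have e : ((2 : ℝ) - 1) / (x - 1) = (x - 1)⁻¹ := by ring
    rw [e, add_sub_cancel_right]
    have := intervalIntegral.norm_integral_le_of_norm_le_const (a := x) (b := 2) (f := h) (C := C)
      fun t ht => hC t (hsub (Set.uIoc_subset_uIcc ht))
    rw [Real.norm_eq_abs] at this
    refine this.trans ?_
    rw [abs_of_nonneg (by linarith)]
    nlinarith

lemma inv_sub_inv_rpow_le {k : ℕ} (hk : 2 ≤ k) {ε : ℝ} (hε : 0 ≤ ε)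
    (hkε : ε * Real.log k ≤ 1) :
    |(k : ℝ)⁻¹ - ((k : ℝ) ^ (1 + ε))⁻¹| ≤ 2 * ε * Real.log k * ((k : ℝ) ^ (1 + ε))⁻¹ := by
  have hk0 : (0 : ℝ) < k := by positivity
  have hlog : 0 ≤ Real.log k := Real.log_nonneg (by exact_mod_cast (by omega : 1 ≤ k))
  have e : (k : ℝ)⁻¹ - ((k : ℝ) ^ (1 + ε))⁻¹ =
      (Real.exp (ε * Real.log k) - 1) * ((k : ℝ) ^ (1 + ε))⁻¹ := by
    rw [Real.rpow_add hk0, Real.rpow_one, Real.rpow_def_of_pos hk0, mul_comm ε]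
    have := Real.exp_pos (Real.log k * ε)
    field_simp
  have h0 : 0 ≤ ε * Real.log k := mul_nonneg hε hlog
  rw [e, abs_mul, abs_of_nonneg (a := ((k : ℝ) ^ (1 + ε))⁻¹) (by positivity)]
  refine mul_le_mul_of_nonneg_right ?_ (by positivity)
  refine (Real.abs_exp_sub_one_le (by rwa [abs_of_nonneg h0])).trans ?_
  rw [abs_of_nonneg h0, mul_assoc]

lemma one_lt_log_of_three_le {n : ℕ} (hn : 3 ≤ n) : 1 < Real.log n := by
  rw [Real.lt_log_iff_exp_lt (by positivity)]
  have h : (3 : ℝ) ≤ n := by exact_mod_cast hn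
  linarith [Real.exp_one_lt_d9]

/-- A Tauberian step: the partial sums at `1` agree, up to a bounded error, with the
Dirichlet series at `1 + 1 / log n`. -/
lemma residueClass_partial_sum_sub_tsum [NeZero q] (ha : IsUnit a) :
    ∃ C : ℝ, ∀ n : ℕ, 3 ≤ n →
      |∑ k ∈ Finset.range (n + 1), residueClass a k / Real.log k * (k : ℝ)⁻¹ -
        ∑' k : ℕ, residueClass a k / Real.log k *
          ((k : ℝ) ^ (1 + (Real.log n)⁻¹))⁻¹| ≤ C := by
  obtain ⟨C, hC0, hC⟩ := integral_residueClass_bound ha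
  refine ⟨2 + 2 * C, fun n hn => ?_⟩
  have hl : 1 < Real.log n := one_lt_log_of_three_le hn
  set ε : ℝ := (Real.log n)⁻¹ with hε
  have hε0 : 0 < ε := by positivity
  have hε1 : ε ≤ 1 := inv_le_one_of_one_le₀ hl.le
  have hεl : ε * Real.log n = 1 := inv_mul_cancel₀ (by positivity)
  have hs := residueClass_summable a (x := 1 + ε) (by linarith)
  have hF := (hC (1 + ε) (by linarith) (by linarith)).1
  rw [add_sub_cancel_left] at hF
  set w : ℕ → ℝ := fun k => if k ∈ Finset.range (n + 1) then
    residueClass a k / Real.log k * (k : ℝ)⁻¹ else 0 with hw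
  have hwsum : HasSum w (∑ k ∈ Finset.range (n + 1),
      residueClass a k / Real.log k * (k : ℝ)⁻¹) := by
    have h : HasSum w (∑ k ∈ Finset.range (n + 1), w k) :=
      hasSum_sum_of_ne_finset_zero fun k hk => if_neg hk
    convert! h using 1
    exact Finset.sum_congr rfl fun k hk => (if_pos hk).symm
  have hterm : ∀ k : ℕ, |w k - residueClass a k / Real.log k * ((k : ℝ) ^ (1 + ε))⁻¹| ≤
      2 * ε * (residueClass a k / (k : ℝ) ^ (1 + ε)) := by
    intro k
    by_cases hk : 2 ≤ k
    swap
    · simp [hw, residueClass_eq_zero_of_lt_two a hk]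
    have hk0 : (0 : ℝ) < k := by positivity
    have hr := residueClass_nonneg a k
    have hlk : 0 < Real.log k := Real.log_pos (by exact_mod_cast hk)
    have hp : 0 ≤ ((k : ℝ) ^ (1 + ε))⁻¹ := by positivity
    by_cases hkn : k ∈ Finset.range (n + 1)
    · have hkn' : k ≤ n := by simpa [Nat.lt_succ_iff] using hkn
      have hlog : Real.log k ≤ Real.log n := Real.log_le_log hk0 (by exact_mod_cast hkn')
      have := inv_sub_inv_rpow_le hk hε0.le
        ((mul_le_mul_of_nonneg_left hlog hε0.le).trans hεl.le)
      simp only [hw, if_pos hkn]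
      rw [← mul_sub, abs_mul, abs_of_nonneg (div_nonneg hr hlk.le)]
      refine (mul_le_mul_of_nonneg_left this (div_nonneg hr hlk.le)).trans_eq ?_
      field_simp
    · have hkn' : n ≤ k := by simp at hkn; omega
      have hlog : Real.log n ≤ Real.log k :=
        Real.log_le_log (by positivity) (by exact_mod_cast hkn')
      simp only [hw, if_neg hkn]
      rw [zero_sub, abs_neg, abs_of_nonneg (by positivity), div_mul_eq_mul_div, div_le_iff₀ hlk]
      have h1 : 1 ≤ ε * Real.log k := hεl.symm.le.trans (mul_le_mul_of_nonneg_left hlog hε0.le)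
      rw [div_eq_mul_inv]
      nlinarith [mul_nonneg hr hp]
  have hdiff : Summable fun k : ℕ =>
      w k - residueClass a k / Real.log k * ((k : ℝ) ^ (1 + ε))⁻¹ :=
    Summable.of_abs <| (hs.mul_left (2 * ε)).of_nonneg_of_le (fun k => abs_nonneg _) hterm
  have hG : Summable fun k : ℕ => residueClass a k / Real.log k * ((k : ℝ) ^ (1 + ε))⁻¹ := by
    have := hwsum.summable.sub hdiff
    simpa using this
  rw [← hwsum.tsum_eq, ← hwsum.summable.tsum_sub hG]
  calc |∑' k, (w k - residueClass a k / Real.log k * ((k : ℝ) ^ (1 + ε))⁻¹)|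
      ≤ ∑' k, 2 * ε * (residueClass a k / (k : ℝ) ^ (1 + ε)) := by
        rw [← Real.norm_eq_abs]
        exact tsum_of_norm_bounded (hs.mul_left (2 * ε)).hasSum hterm
    _ = 2 * ε * ∑' k, residueClass a k / (k : ℝ) ^ (1 + ε) := tsum_mul_left
    _ ≤ 2 * ε * (ε⁻¹ + C) := by gcongr
    _ = 2 + 2 * ε * C := by field_simp
    _ ≤ 2 + 2 * C := by nlinarith

lemma residueClass_partial_sum [NeZero q] (ha : IsUnit a) :
    ∃ C : ℝ, ∀ n : ℕ, 3 ≤ n →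
      |∑ k ∈ Finset.range (n + 1), residueClass a k / Real.log k * (k : ℝ)⁻¹ -
        (q.totient : ℝ)⁻¹ * LL n| ≤ C := by
  obtain ⟨C, hC0, hC⟩ := integral_residueClass_bound ha
  obtain ⟨C', hC'⟩ := residueClass_partial_sum_sub_tsum ha
  set K : ℝ := ∑' k : ℕ, residueClass a k / Real.log k * ((k : ℝ) ^ (2 : ℝ))⁻¹ with hK
  refine ⟨C' + C + |K|, fun n hn => ?_⟩
  have hl : 1 < Real.log n := one_lt_log_of_three_le hn
  have h1 := hC' n hn
  set ε : ℝ := (Real.log n)⁻¹ with hε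
  have hε0 : 0 < ε := by positivity
  have hε1 : ε ≤ 1 := inv_le_one_of_one_le₀ hl.le
  have hI := (hC (1 + ε) (by linarith) (by linarith)).2
  have hsum := hasSum_residueClass_log a (x := 1 + ε) (by linarith) (by linarith)
  have hsx : ∀ x : ℝ, 1 < x →
      Summable fun k : ℕ => residueClass a k / Real.log k * ((k : ℝ) ^ x)⁻¹ := by
    intro x hx
    refine ((residueClass_summable a hx).mul_left (Real.log 2)⁻¹).of_nonneg_of_le
      (fun k => ?_) fun k => ?_
    · exact mul_nonneg (div_nonneg (residueClass_nonneg a k) (Real.log_natCast_nonneg k))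
        (by positivity)
    · by_cases hk : 2 ≤ k
      · have hlk : Real.log 2 ≤ Real.log k := Real.log_le_log (by norm_num) (by exact_mod_cast hk)
        have h2 : 0 < Real.log 2 := Real.log_pos (by norm_num)
        have h3 : (Real.log k)⁻¹ ≤ (Real.log 2)⁻¹ := inv_anti₀ h2 hlk
        have hr := residueClass_nonneg a k
        have hp : 0 ≤ ((k : ℝ) ^ x)⁻¹ := by positivity
        rw [div_eq_mul_inv, div_eq_mul_inv]
        nlinarith [mul_nonneg hr hp]
      · simp [residueClass_eq_zero_of_lt_two a hk]
  have hsub := hsum.tsum_eq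
  simp_rw [mul_sub] at hsub
  rw [(hsx _ (by linarith)).tsum_sub (hsx 2 (by norm_num)), ← hK] at hsub
  rw [add_sub_cancel_left, hε, inv_inv, ← hε, ← hsub] at hI
  rw [LL]
  have h3 := abs_le.mp h1
  have h4 := abs_le.mp hI
  have h5 := neg_abs_le K
  have h6 := le_abs_self K
  rw [abs_le]
  constructor <;> linarith [h3.1, h3.2, h4.1, h4.2]

/-- Mertens' second theorem for primes congruent to `1` modulo `q`. -/
theorem recipSum_sub_loglog_bounded (q : ℕ) (hq : 0 < q) :
    ∃ C : ℝ, ∀ n : ℕ, 3 ≤ n → |recipSum q n - (q.totient : ℝ)⁻¹ * LL n| ≤ C := by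
  have : NeZero q := ⟨hq.ne'⟩
  obtain ⟨C, hC⟩ := residueClass_partial_sum (a := (1 : ZMod q)) isUnit_one
  have hs := summable_residueClass_non_primes_div (1 : ZMod q)
  set K : ℝ := ∑' n : ℕ, (if n.Prime then 0 else residueClass (1 : ZMod q) n) / (n : ℝ) with hK
  refine ⟨C + (Real.log 2)⁻¹ * K, fun n hn => ?_⟩
  have h2 : 0 < Real.log 2 := Real.log_pos (by norm_num)
  have hnn : ∀ k : ℕ, 0 ≤ (if k.Prime then 0 else residueClass (1 : ZMod q) k) / (k : ℝ) := by
    intro k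
    split_ifs
    · simp
    · exact div_nonneg (residueClass_nonneg _ k) (by positivity)
  have hsplit : ∑ k ∈ Finset.range (n + 1), residueClass (1 : ZMod q) k / Real.log k * (k : ℝ)⁻¹ =
      recipSum q n + ∑ k ∈ Finset.range (n + 1), (Real.log k)⁻¹ *
        ((if k.Prime then 0 else residueClass (1 : ZMod q) k) / (k : ℝ)) := by
    rw [recipSum, apPrimes, Finset.sum_filter, ← Finset.sum_add_distrib]
    refine Finset.sum_congr rfl fun k _ => ?_
    by_cases hp : k.Prime
    · have hlk : Real.log k ≠ 0 := (Real.log_pos (by exact_mod_cast hp.one_lt)).ne'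
      have hiff : ((k : ZMod q) = 1) ↔ k ≡ 1 [MOD q] := by
        rw [← ZMod.natCast_eq_natCast_iff, Nat.cast_one]
      by_cases hk : k ≡ 1 [MOD q]
      · have : residueClass (1 : ZMod q) k = Real.log k := by
          rw [residueClass, Set.indicator_of_mem (by exact hiff.mpr hk), vonMangoldt_apply_prime hp]
        simp [hp, hk, this, hlk]
      · have : residueClass (1 : ZMod q) k = 0 := by
          rw [residueClass, Set.indicator_of_notMem (by exact fun h => hk (hiff.mp h))]
        simp [hp, hk, this]
    · simp only [hp, false_and, if_false, zero_add]
      ring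
  have hE0 : 0 ≤ ∑ k ∈ Finset.range (n + 1), (Real.log k)⁻¹ *
      ((if k.Prime then 0 else residueClass (1 : ZMod q) k) / (k : ℝ)) :=
    Finset.sum_nonneg fun k _ => mul_nonneg (inv_nonneg.mpr (Real.log_natCast_nonneg k)) (hnn k)
  have hE1 : ∑ k ∈ Finset.range (n + 1), (Real.log k)⁻¹ *
      ((if k.Prime then 0 else residueClass (1 : ZMod q) k) / (k : ℝ)) ≤ (Real.log 2)⁻¹ * K := by
    rw [hK]
    refine le_trans ?_ (mul_le_mul_of_nonneg_left
      (hs.sum_le_tsum (Finset.range (n + 1)) fun k _ => hnn k) (inv_nonneg.mpr h2.le))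
    rw [Finset.mul_sum]
    refine Finset.sum_le_sum fun k _ => ?_
    by_cases hk : 2 ≤ k
    · refine mul_le_mul_of_nonneg_right ?_ (hnn k)
      exact inv_anti₀ h2 (Real.log_le_log (by norm_num) (by exact_mod_cast hk))
    · simp [residueClass_eq_zero_of_lt_two _ hk]
  have h := hC n hn
  rw [hsplit] at h
  have h' := abs_le.mp h
  rw [abs_le]
  constructor <;> linarith [h'.1, h'.2]

end MertensAP

/-- The average of `f` over `{1, …, n}`. -/
def mean (f : ℕ → ℝ) (n : ℕ) : ℝ := (∑ m ∈ Finset.Icc 1 n, f m) / n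

section Mean

lemma mean_mono {f g : ℕ → ℝ} {n : ℕ} (h : ∀ m, 1 ≤ m → m ≤ n → f m ≤ g m) :
    mean f n ≤ mean g n := by
  refine div_le_div_of_nonneg_right (Finset.sum_le_sum fun m hm => ?_) (Nat.cast_nonneg n)
  rw [Finset.mem_Icc] at hm
  exact h m hm.1 hm.2

lemma mean_add (f g : ℕ → ℝ) (n : ℕ) : mean (fun m => f m + g m) n = mean f n + mean g n := by
  simp only [mean, Finset.sum_add_distrib, add_div]

lemma mean_sub (f g : ℕ → ℝ) (n : ℕ) : mean (fun m => f m - g m) n = mean f n - mean g n := by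
  simp only [mean, Finset.sum_sub_distrib, sub_div]

lemma mean_const_mul (c : ℝ) (f : ℕ → ℝ) (n : ℕ) : mean (fun m => c * f m) n = c * mean f n := by
  simp only [mean, ← Finset.mul_sum, mul_div_assoc]

lemma mean_const (c : ℝ) {n : ℕ} (hn : 0 < n) : mean (fun _ => c) n = c := by
  have : (n : ℝ) ≠ 0 := by positivity
  simp [mean, this]

lemma mean_sum {ι : Type*} (s : Finset ι) (f : ι → ℕ → ℝ) (n : ℕ) :
    mean (fun m => ∑ i ∈ s, f i m) n = ∑ i ∈ s, mean (f i) n := by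
  simp only [mean]
  rw [Finset.sum_comm, Finset.sum_div]

lemma mean_dvd_le (k n : ℕ) : mean (fun m => if k ∣ m then 1 else 0) n ≤ (k : ℝ)⁻¹ := by
  rcases Nat.eq_zero_or_pos n with rfl | hn
  · simp [mean]
  have hc : (∑ m ∈ Finset.Icc 1 n, if k ∣ m then (1 : ℝ) else 0) = ((n / k : ℕ) : ℝ) := by
    rw [← Finset.sum_filter, Finset.sum_const, nsmul_eq_mul, mul_one]
    exact congrArg _ (Nat.Ioc_filter_dvd_card_eq_div n k)
  rw [mean, hc, div_le_iff₀ (by positivity), mul_comm, ← div_eq_mul_inv]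
  exact Nat.cast_div_le

lemma le_mean_dvd (k : ℕ) {n : ℕ} (hn : 0 < n) :
    (k : ℝ)⁻¹ - (n : ℝ)⁻¹ ≤ mean (fun m => if k ∣ m then 1 else 0) n := by
  have hc : (∑ m ∈ Finset.Icc 1 n, if k ∣ m then (1 : ℝ) else 0) = ((n / k : ℕ) : ℝ) := by
    rw [← Finset.sum_filter, Finset.sum_const, nsmul_eq_mul, mul_one]
    exact congrArg _ (Nat.Ioc_filter_dvd_card_eq_div n k)
  have hn' : (0 : ℝ) < n := by positivity
  rw [mean, hc, le_div_iff₀ hn', sub_mul, inv_mul_cancel₀ hn'.ne', mul_comm, ← div_eq_mul_inv,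
    ← Nat.floor_div_eq_div (K := ℝ)]
  exact (Nat.sub_one_lt_floor _).le

end Mean

section Moments

variable {q n : ℕ}

lemma prime_of_mem_apPrimes {r : ℕ} (h : r ∈ apPrimes q n) : r.Prime :=
  (Finset.mem_filter.mp h).2.1

lemma apPrimes_filter_dvd {m : ℕ} (h1 : 1 ≤ m) (h2 : m ≤ n) :
    (apPrimes q n).filter (· ∣ m) = m.primeFactors.filter fun p => p % q = 1 % q := by
  ext r
  simp only [apPrimes, Finset.mem_filter, Finset.mem_range, Nat.mem_primeFactors]
  constructor
  · rintro ⟨⟨_, hp, hr⟩, hd⟩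
    exact ⟨⟨hp, hd, by omega⟩, hr⟩
  · rintro ⟨⟨hp, hd, _⟩, hr⟩
    exact ⟨⟨by have := Nat.le_of_dvd h1 hd; omega, hp, hr⟩, hd⟩

lemma omegaQ_eq_sum {m : ℕ} (h1 : 1 ≤ m) (h2 : m ≤ n) :
    (omegaQ m q : ℝ) = ∑ r ∈ apPrimes q n, if r ∣ m then 1 else 0 := by
  rw [omegaQ, ← apPrimes_filter_dvd h1 h2, ← Finset.sum_filter]
  simp

lemma recipSum_nonneg (q n : ℕ) : 0 ≤ recipSum q n :=
  Finset.sum_nonneg fun r _ => by positivity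

lemma mean_congr {f g : ℕ → ℝ} (h : ∀ m, 1 ≤ m → m ≤ n → f m = g m) : mean f n = mean g n :=
  le_antisymm (mean_mono fun m h1 h2 => (h m h1 h2).le) (mean_mono fun m h1 h2 => (h m h1 h2).ge)

lemma mean_omegaQ_le (q n : ℕ) : mean (fun m => omegaQ m q) n ≤ recipSum q n := by
  rw [mean_congr fun m h1 h2 => omegaQ_eq_sum h1 h2, mean_sum]
  exact Finset.sum_le_sum fun r _ => mean_dvd_le r n

lemma le_mean_omegaQ (q : ℕ) (hn : 0 < n) : recipSum q n - 1 ≤ mean (fun m => omegaQ m q) n := by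
  rw [mean_congr fun m h1 h2 => omegaQ_eq_sum h1 h2, mean_sum]
  refine le_trans ?_ (Finset.sum_le_sum fun r _ => le_mean_dvd r hn)
  rw [Finset.sum_sub_distrib, Finset.sum_const, nsmul_eq_mul, recipSum]
  refine sub_le_sub_left ?_ _
  rw [← div_eq_mul_inv, div_le_one (by positivity)]
  have hsub : apPrimes q n ⊆ Finset.Icc 1 n := by
    intro r hr
    have h := Finset.mem_filter.mp hr
    have := h.2.1.one_lt
    have := Finset.mem_range.mp h.1
    rw [Finset.mem_Icc]
    omega
  exact_mod_cast (Finset.card_le_card hsub).trans (by simp)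

lemma mean_omegaQ_mul_pred_le (q n : ℕ) :
    mean (fun m => (omegaQ m q : ℝ) * (omegaQ m q - 1)) n ≤ recipSum q n ^ 2 := by
  have h : ∀ m, 1 ≤ m → m ≤ n → (omegaQ m q : ℝ) * (omegaQ m q - 1) =
      ∑ x ∈ (apPrimes q n).offDiag, if x.1 * x.2 ∣ m then 1 else 0 := by
    intro m h1 h2
    have e : ((apPrimes q n).offDiag.filter fun x => x.1 * x.2 ∣ m) =
        ((apPrimes q n).filter (· ∣ m)).offDiag := by
      ext ⟨x, y⟩
      simp only [Finset.mem_filter, Finset.mem_offDiag]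
      constructor
      · rintro ⟨⟨hx, hy, hne⟩, hd⟩
        exact ⟨⟨hx, (Dvd.intro _ rfl).trans hd⟩, ⟨hy, (Dvd.intro_left _ rfl).trans hd⟩, hne⟩
      · rintro ⟨⟨hx, hxd⟩, ⟨hy, hyd⟩, hne⟩
        exact ⟨⟨hx, hy, hne⟩, ((Nat.coprime_primes (prime_of_mem_apPrimes hx)
          (prime_of_mem_apPrimes hy)).mpr hne).mul_dvd_of_dvd_of_dvd hxd hyd⟩
    rw [← Finset.sum_filter, e, Finset.sum_const, nsmul_eq_mul, mul_one, Finset.offDiag_card,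
      apPrimes_filter_dvd h1 h2, ← omegaQ, Nat.cast_sub (Nat.le_mul_self _)]
    push_cast
    ring
  rw [mean_congr h, mean_sum, sq, recipSum, Finset.sum_mul_sum, ← Finset.sum_product']
  calc _ ≤ ∑ x ∈ (apPrimes q n).offDiag, ((x.1 : ℝ)⁻¹ * (x.2 : ℝ)⁻¹) := by
        refine Finset.sum_le_sum fun x _ => (mean_dvd_le _ n).trans_eq ?_
        push_cast
        rw [mul_inv]
    _ ≤ _ := Finset.sum_le_sum_of_subset_of_nonneg
        (fun x hx => by
          rw [Finset.mem_offDiag] at hx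
          exact Finset.mem_product.mpr ⟨hx.1, hx.2.1⟩) fun x _ _ => by positivity

/-- Turán's inequality. -/
lemma mean_omegaQ_sub_sq_le (q : ℕ) (hn : 0 < n) :
    mean (fun m => ((omegaQ m q : ℝ) - recipSum q n) ^ 2) n ≤ 3 * recipSum q n := by
  have h : mean (fun m => ((omegaQ m q : ℝ) - recipSum q n) ^ 2) n =
      mean (fun m => (omegaQ m q : ℝ) * (omegaQ m q - 1)) n +
      (1 - 2 * recipSum q n) * mean (fun m => omegaQ m q) n + recipSum q n ^ 2 := by
    rw [← mean_const_mul, ← mean_add]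
    rw [← mean_const (recipSum q n ^ 2) hn]
    rw [← mean_add]
    exact mean_congr fun m _ _ => by ring
  rw [h]
  nlinarith [mean_omegaQ_mul_pred_le q n, mean_omegaQ_le q n, le_mean_omegaQ q hn,
    recipSum_nonneg q n]

lemma mean_pow_omegaQ_le (q n : ℕ) {y : ℝ} (hy : 0 ≤ y) :
    mean (fun m => (1 + y) ^ omegaQ m q) n ≤ Real.exp (y * recipSum q n) := by
  have h : ∀ m, 1 ≤ m → m ≤ n → (1 + y) ^ omegaQ m q =
      ∑ s ∈ (apPrimes q n).powerset, y ^ s.card * if (∏ r ∈ s, r) ∣ m then 1 else 0 := by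
    intro m h1 h2
    have e : ((apPrimes q n).powerset.filter fun s => (∏ r ∈ s, r) ∣ m) =
        ((apPrimes q n).filter (· ∣ m)).powerset := by
      ext s
      simp only [Finset.mem_filter, Finset.mem_powerset]
      constructor
      · rintro ⟨hs, hd⟩ r hr
        exact Finset.mem_filter.mpr ⟨hs hr, (Finset.dvd_prod_of_mem _ hr).trans hd⟩
      · intro hs
        refine ⟨fun r hr => (Finset.mem_filter.mp (hs hr)).1, ?_⟩
        refine Finset.prod_primes_dvd m (fun r hr => ?_) fun r hr => ?_
        · exact (prime_of_mem_apPrimes (Finset.mem_filter.mp (hs hr)).1).prime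
        · exact (Finset.mem_filter.mp (hs hr)).2
    simp_rw [mul_ite, mul_one, mul_zero]
    rw [← Finset.sum_filter, e, omegaQ, ← apPrimes_filter_dvd h1 h2, ← Finset.prod_const,
      Finset.prod_one_add]
    simp
  rw [mean_congr h, mean_sum]
  calc _ ≤ ∑ s ∈ (apPrimes q n).powerset, ∏ r ∈ s, y * (r : ℝ)⁻¹ := by
        refine Finset.sum_le_sum fun s _ => ?_
        rw [mean_const_mul, Finset.prod_mul_distrib, Finset.prod_const, Finset.prod_inv_distrib]
        refine mul_le_mul_of_nonneg_left ((mean_dvd_le _ n).trans_eq ?_) (by positivity)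
        push_cast
        rfl
    _ = ∏ r ∈ apPrimes q n, (1 + y * (r : ℝ)⁻¹) := (Finset.prod_one_add _).symm
    _ ≤ ∏ r ∈ apPrimes q n, Real.exp (y * (r : ℝ)⁻¹) := by
        refine Finset.prod_le_prod (fun r _ => by positivity) fun r _ => ?_
        rw [add_comm]
        exact Real.add_one_le_exp _
    _ = _ := by rw [← Real.exp_sum, recipSum, Finset.mul_sum]

lemma LL_pos {n : ℕ} (hn : 3 ≤ n) : 0 < LL n := Real.log_pos (one_lt_log_of_three_le hn)

lemma LL_three_le {n : ℕ} (hn : 3 ≤ n) : LL 3 ≤ LL n := by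
  have h := one_lt_log_of_three_le (le_refl 3)
  refine Real.log_le_log (by linarith) (Real.log_le_log (by norm_num) ?_)
  exact_mod_cast hn

lemma max_sub_add_le {x s K : ℝ} (hs : 0 < s) (hK : 0 ≤ K) :
    max (x - s + K) 0 ≤ K + (4 * s)⁻¹ * x ^ 2 := by
  have h : 0 ≤ (4 * s)⁻¹ * x ^ 2 := by positivity
  refine max_le ?_ (by linarith)
  have : x - s ≤ (4 * s)⁻¹ * x ^ 2 := by
    rw [inv_mul_eq_div, le_div_iff₀ (by positivity)]
    nlinarith [sq_nonneg (x - 2 * s)]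
  linarith

lemma mean_deviation_bounded (hq : 0 < q) {η K : ℝ} (hη : 0 < η) (hK : 0 ≤ K) :
    ∃ C : ℝ, ∀ n : ℕ, 3 ≤ n →
      mean (fun m => K + (4 * (η * LL n))⁻¹ * ((omegaQ m q : ℝ) - recipSum q n) ^ 2) n ≤ C := by
  obtain ⟨C, hC⟩ := recipSum_sub_loglog_bounded q hq
  have hl := LL_pos (le_refl 3)
  refine ⟨K + (3 / (4 * η)) * ((q.totient : ℝ)⁻¹ + |C| / LL 3), fun n hn => ?_⟩
  have hL := LL_pos hn
  have hL3 := LL_three_le hn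
  rw [mean_add, mean_const _ (by omega), mean_const_mul]
  have h1 := mean_omegaQ_sub_sq_le (n := n) q (by omega)
  have h2 := (abs_le.mp (hC n hn)).2
  have h3 : recipSum q n ≤ ((q.totient : ℝ)⁻¹ + |C| / LL 3) * LL n := by
    have : |C| ≤ |C| / LL 3 * LL n := by
      rw [div_mul_eq_mul_div, le_div_iff₀ hl]
      exact mul_le_mul_of_nonneg_left hL3 (abs_nonneg C)
    nlinarith [le_abs_self C]
  have h4 : (4 * (η * LL n))⁻¹ * mean (fun m => ((omegaQ m q : ℝ) - recipSum q n) ^ 2) n ≤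
      (4 * (η * LL n))⁻¹ * (3 * (((q.totient : ℝ)⁻¹ + |C| / LL 3) * LL n)) :=
    mul_le_mul_of_nonneg_left (h1.trans (by linarith)) (by positivity)
  refine (add_le_add_right h4 K).trans_eq ?_
  field_simp

lemma mean_omegaQ_excess_bounded (hq : 0 < q) {c : ℝ} (hc : (q.totient : ℝ)⁻¹ < c) :
    ∃ C : ℝ, ∀ n : ℕ, 3 ≤ n → mean (fun m => max ((omegaQ m q : ℝ) + 2 - c * LL n) 0) n ≤ C := by
  obtain ⟨C, hC⟩ := recipSum_sub_loglog_bounded q hq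
  obtain ⟨C', hC'⟩ := mean_deviation_bounded hq (sub_pos.mpr hc) (K := 2 + |C|) (by positivity)
  refine ⟨C', fun n hn => (mean_mono fun m _ _ => ?_).trans (hC' n hn)⟩
  refine le_trans ?_ (max_sub_add_le (mul_pos (sub_pos.mpr hc) (LL_pos hn)) (by positivity))
  refine max_le_max_right _ ?_
  have h2 := (abs_le.mp (hC n hn)).2
  have h3 := le_abs_self C
  linarith

lemma mean_omegaQ_deficit_bounded (hq : 0 < q) {c : ℝ} (hc : c < (q.totient : ℝ)⁻¹) :
    ∃ C : ℝ, ∀ n : ℕ, 3 ≤ n → mean (fun m => max (c * LL n - (omegaQ m q : ℝ)) 0) n ≤ C := by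
  obtain ⟨C, hC⟩ := recipSum_sub_loglog_bounded q hq
  obtain ⟨C', hC'⟩ := mean_deviation_bounded hq (sub_pos.mpr hc) (K := |C|) (by positivity)
  refine ⟨C', fun n hn => (mean_mono fun m _ _ => ?_).trans (hC' n hn)⟩
  have h := max_sub_add_le (x := -((omegaQ m q : ℝ) - recipSum q n))
    (mul_pos (sub_pos.mpr hc) (LL_pos hn)) (abs_nonneg C)
  rw [neg_sq] at h
  refine le_trans (max_le_max_right _ ?_) h
  have h2 := (abs_le.mp (hC n hn)).1
  have h3 := le_abs_self C
  linarith

end Moments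

lemma ordCompl_factorial_dvd_prod {p : ℕ} (hp : p.Prime) (K : ℕ) :
    K.factorial / p ^ K.factorial.factorization p ∣ ∏ k ∈ Finset.range K, ((k + 1) * p + 1) := by
  set W := K.factorial / p ^ K.factorial.factorization p with hW
  have hpW : Nat.Coprime p W :=
    (Nat.Prime.coprime_iff_not_dvd hp).2 (Nat.not_dvd_ordCompl hp (Nat.factorial_ne_zero K))
  have hW0 : NeZero W := ⟨fun h => hp.one_lt.ne' (by simpa [h] using hpW)⟩
  obtain ⟨s, hs⟩ : ∃ s : ℕ, (p : ZMod W) * s = 1 := by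
    refine ⟨(((ZMod.unitOfCoprime p hpW)⁻¹ : (ZMod W)ˣ) : ZMod W).val, ?_⟩
    rw [ZMod.natCast_zmod_val, ← ZMod.coe_unitOfCoprime p hpW, Units.mul_inv]
  have hdvd : W ∣ (s + 1).ascFactorial K :=
    (Nat.ordCompl_dvd _ _).trans (Nat.factorial_dvd_ascFactorial _ _)
  rw [← ZMod.natCast_eq_zero_iff] at hdvd ⊢
  have : ((∏ k ∈ Finset.range K, ((k + 1) * p + 1) : ℕ) : ZMod W)
      = (p : ZMod W) ^ K * (((s + 1).ascFactorial K : ℕ) : ZMod W) := by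
    rw [Nat.ascFactorial_eq_prod_range]
    push_cast
    rw [← Finset.card_range K, ← Finset.prod_const, Finset.card_range, ← Finset.prod_mul_distrib]
    refine Finset.prod_congr rfl fun k _ => ?_
    linear_combination (-1 : ZMod W) * hs
  rw [this, hdvd, mul_zero]

lemma prod_primes_modEq_one_le {p : ℕ} (hp : p.Prime) (K : ℕ) (T : Finset ℕ)
    (hT : ∀ r ∈ T, r.Prime ∧ r ≡ 1 [MOD p] ∧ K < r ∧ r ≤ K * p + 1) :
    ∏ r ∈ T, r ≤ p ^ (3 * K) := by
  set v := K.factorial.factorization p with hv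
  set W := K.factorial / p ^ v with hW
  set N := ∏ k ∈ Finset.range K, ((k + 1) * p + 1) with hN
  have hfac : p ^ v * W = K.factorial := Nat.ordProj_mul_ordCompl_eq_self _ _
  have hWpos : 0 < W := Nat.pos_of_ne_zero fun h => Nat.factorial_ne_zero K (by rw [← hfac, h, mul_zero])
  have hR : ∏ r ∈ T, r ∣ N := by
    refine Finset.prod_primes_dvd N (fun r hr => (hT r hr).1.prime) fun r hr => ?_
    obtain ⟨hrp, hr1, -, hrK⟩ := hT r hr
    obtain ⟨k, hk⟩ := (Nat.modEq_iff_dvd' hrp.one_lt.le).1 hr1.symm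
    have h2 := hrp.two_le
    have hk' : r = k * p + 1 := by rw [mul_comm]; omega
    have hk0 : k ≠ 0 := by rintro rfl; omega
    have hkK : k ≤ K := by
      have : k * p ≤ K * p := by omega
      exact Nat.le_of_mul_le_mul_right this hp.pos
    have := Finset.dvd_prod_of_mem (fun k => (k + 1) * p + 1)
      (Finset.mem_range.2 (show k - 1 < K by omega))
    rwa [show k - 1 + 1 = k by omega, ← hk'] at this
  have hcop : Nat.Coprime (∏ r ∈ T, r) W := by
    refine Nat.Coprime.prod_left fun r hr => ?_
    obtain ⟨hrp, -, hrK, -⟩ := hT r hr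
    refine Nat.Coprime.coprime_dvd_right (Nat.ordCompl_dvd _ _) ?_
    rw [Nat.Prime.coprime_iff_not_dvd hrp, hrp.dvd_factorial]
    omega
  have hRW : (∏ r ∈ T, r) * W ∣ N :=
    hcop.mul_dvd_of_dvd_of_dvd hR (ordCompl_factorial_dvd_prod hp K)
  have hN0 : 0 < N := Finset.prod_pos fun k _ => Nat.succ_pos _
  have hNle : N ≤ K.factorial * (p + 1) ^ K := by
    rw [← Finset.prod_range_add_one_eq_factorial]
    nth_rw 2 [← Finset.card_range K]
    rw [← Finset.prod_const, ← Finset.prod_mul_distrib]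
    refine Finset.prod_le_prod' fun k _ => ?_
    nlinarith
  have h1 : (∏ r ∈ T, r) * W ≤ (p ^ v * (p + 1) ^ K) * W := by
    refine (Nat.le_of_dvd hN0 hRW).trans (hNle.trans (le_of_eq ?_))
    rw [← hfac]; ring
  have h2 : ∏ r ∈ T, r ≤ p ^ v * (p + 1) ^ K := Nat.le_of_mul_le_mul_right h1 hWpos
  have hvK : v ≤ K := (Nat.factorization_factorial_le_div_pred hp K).trans (Nat.div_le_self _ _)
  have hp1 : (p + 1) ^ K ≤ (p ^ 2) ^ K := Nat.pow_le_pow_left (by nlinarith [hp.two_le]) K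
  calc _ ≤ p ^ v * (p + 1) ^ K := h2
    _ ≤ p ^ K * (p ^ 2) ^ K := Nat.mul_le_mul (Nat.pow_le_pow_right hp.pos hvK) hp1
    _ = _ := by rw [← pow_mul, ← pow_add]; ring_nf

/-- The primes in `(2 ^ j, 2 ^ (j + 1)]` that are `1` modulo `p`. -/
def dyadicPrimes (p j : ℕ) : Finset ℕ :=
  (Finset.Ioc (2 ^ j) (2 ^ (j + 1))).filter fun r => r.Prime ∧ r ≡ 1 [MOD p]

lemma dyadicPrimes_pairwiseDisjoint (p : ℕ) (s : Set ℕ) :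
    s.PairwiseDisjoint (dyadicPrimes p) := by
  have key : ∀ i j r, i < j → r ∈ dyadicPrimes p i → r ∉ dyadicPrimes p j := by
    intro i j r hij h1 h2
    simp only [dyadicPrimes, Finset.mem_filter, Finset.mem_Ioc] at h1 h2
    have := Nat.pow_le_pow_right two_pos (show i + 1 ≤ j from hij)
    omega
  intro i _ j _ hij
  refine Finset.disjoint_left.2 fun r h1 h2 => ?_
  rcases hij.lt_or_gt with h | h
  · exact key i j r h h1 h2
  · exact key j i r h h2 h1

lemma sum_inv_dyadicPrimes_le {p : ℕ} (hp : p.Prime) {j : ℕ} (hj : 0 < j) :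
    ∑ r ∈ dyadicPrimes p j, (r : ℝ)⁻¹ ≤ 12 * (Real.log p / p) * (j : ℝ)⁻¹ := by
  set T := dyadicPrimes p j
  set K := 2 ^ (j + 1) / p
  have hmem : ∀ r ∈ T, (2 ^ j < r ∧ r ≤ 2 ^ (j + 1)) ∧ r.Prime ∧ r ≡ 1 [MOD p] := by
    intro r hr
    simpa only [T, dyadicPrimes, Finset.mem_filter, Finset.mem_Ioc] using hr
  have hprod : ∏ r ∈ T, r ≤ p ^ (3 * K) := by
    refine prod_primes_modEq_one_le hp K T fun r hr => ?_
    obtain ⟨⟨h1, h2⟩, h3, h4⟩ := hmem r hr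
    refine ⟨h3, h4, ?_, ?_⟩
    · refine lt_of_le_of_lt ?_ h1
      calc K ≤ 2 ^ (j + 1) / 2 := Nat.div_le_div_left hp.two_le two_pos
        _ = 2 ^ j := by rw [pow_succ]; simp
    · obtain ⟨k, hk⟩ := (Nat.modEq_iff_dvd' h3.one_lt.le).1 h4.symm
      have : k ≤ K := by
        rw [Nat.le_div_iff_mul_le hp.pos, mul_comm]
        omega
      have := Nat.mul_le_mul_right p this
      rw [mul_comm k p] at this
      omega
  have hcard : (2 ^ j) ^ T.card ≤ p ^ (3 * K) := by
    refine le_trans ?_ hprod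
    rw [← Finset.prod_const]
    exact Finset.prod_le_prod' fun r hr => (hmem r hr).1.1.le
  have hlog : (T.card : ℝ) * (j * Real.log 2) ≤ 3 * K * Real.log p := by
    have h := Real.log_le_log (by positivity) (Nat.cast_le (α := ℝ).2 hcard)
    push_cast at h
    rw [Real.log_pow, Real.log_pow, Real.log_pow] at h
    push_cast at h
    exact h
  have hlogp : 0 ≤ Real.log p := Real.log_natCast_nonneg p
  have hp0 : (0 : ℝ) < p := by exact_mod_cast hp.pos
  have hj0 : (0 : ℝ) < j := by exact_mod_cast hj
  have hK : (K : ℝ) ≤ 2 ^ (j + 1) / p := by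
    simpa using (Nat.cast_div_le (α := ℝ) (m := 2 ^ (j + 1)) (n := p))
  have hl2 : (1 : ℝ) / 2 ≤ Real.log 2 := by linarith [Real.log_two_gt_d9]
  have hsum : ∑ r ∈ T, (r : ℝ)⁻¹ ≤ T.card * ((2 : ℝ) ^ j)⁻¹ := by
    rw [← nsmul_eq_mul, ← Finset.sum_const]
    refine Finset.sum_le_sum fun r hr => ?_
    have : (2 : ℝ) ^ j ≤ r := by exact_mod_cast (hmem r hr).1.1.le
    exact inv_anti₀ (by positivity) this
  refine hsum.trans ?_
  have h1 : (T.card : ℝ) * (j * (1 / 2)) ≤ 3 * (2 ^ (j + 1) / p) * Real.log p := by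
    calc (T.card : ℝ) * (j * (1 / 2)) ≤ T.card * (j * Real.log 2) := by gcongr
      _ ≤ _ := hlog
      _ ≤ _ := by gcongr
  rw [← div_eq_mul_inv, ← div_eq_mul_inv, div_le_div_iff₀ (by positivity) hj0]
  have h2 : (3 : ℝ) * (2 ^ (j + 1) / p) * Real.log p = 6 * (Real.log p / p) * 2 ^ j := by
    rw [pow_succ]; ring
  rw [h2] at h1
  linarith

lemma recipSum_le_log_div {p : ℕ} (hp : p.Prime) (hp2 : 2 < p) {n : ℕ} (hn : 3 ≤ n) :
    recipSum p n ≤ 12 * (Real.log p / p) * (LL n + 2) := by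
  set M := Nat.log 2 n
  have hsub : apPrimes p n ⊆ (Finset.Icc 1 M).biUnion (dyadicPrimes p) := by
    intro r hr
    simp only [apPrimes, Finset.mem_filter, Finset.mem_range] at hr
    obtain ⟨hrn, hrp, hr1⟩ := hr
    have hrgt : p < r := by
      by_contra h
      rcases (not_lt.1 h).lt_or_eq with h | h
      · have : r = 1 := Nat.ModEq.eq_of_lt_of_lt hr1 h (by omega)
        exact hrp.one_lt.ne' this
      · subst h
        have : r ∣ 1 := (Nat.modEq_zero_iff_dvd.1 (hr1.symm.trans (by simp [Nat.ModEq])))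
        exact hrp.one_lt.ne' (Nat.dvd_one.1 this)
    have hne : r - 1 ≠ 0 := by omega
    rw [Finset.mem_biUnion]
    refine ⟨Nat.log 2 (r - 1), ?_, ?_⟩
    · rw [Finset.mem_Icc]
      exact ⟨Nat.log_pos one_lt_two (by omega), Nat.log_mono_right (by omega)⟩
    · have h1 := Nat.pow_log_le_self 2 hne
      have h2 := Nat.lt_pow_succ_log_self one_lt_two (r - 1)
      simp only [dyadicPrimes, Finset.mem_filter, Finset.mem_Ioc]
      refine ⟨⟨by omega, by omega⟩, hrp, hr1⟩
  have hlogp : 0 ≤ Real.log p := Real.log_natCast_nonneg p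
  have hM : 0 < M := Nat.log_pos one_lt_two (by omega)
  have hMlog : (M : ℝ) ≤ 2 * Real.log n := by
    have h := Real.log_le_log (by positivity)
      (Nat.cast_le (α := ℝ).2 (Nat.pow_log_le_self 2 (show n ≠ 0 by omega)))
    push_cast at h
    rw [Real.log_pow] at h
    have hl2 : (1 : ℝ) / 2 ≤ Real.log 2 := by linarith [Real.log_two_gt_d9]
    have : (M : ℝ) * (1 / 2) ≤ M * Real.log 2 := by gcongr
    linarith
  have hharm : ∑ j ∈ Finset.Icc 1 M, ((j : ℝ))⁻¹ ≤ 1 + Real.log M := by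
    have := harmonic_le_one_add_log M
    rw [harmonic_eq_sum_Icc] at this
    push_cast at this
    exact this
  have hlogM : Real.log M ≤ Real.log 2 + LL n := by
    have hl := one_lt_log_of_three_le hn
    rw [LL, ← Real.log_mul (by norm_num) (by positivity)]
    exact Real.log_le_log (by exact_mod_cast hM) hMlog
  have hl2' : Real.log 2 ≤ 1 := by linarith [Real.log_two_lt_d9]
  calc recipSum p n ≤ ∑ r ∈ (Finset.Icc 1 M).biUnion (dyadicPrimes p), (r : ℝ)⁻¹ :=
        Finset.sum_le_sum_of_subset_of_nonneg hsub fun _ _ _ => by positivity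
    _ = ∑ j ∈ Finset.Icc 1 M, ∑ r ∈ dyadicPrimes p j, (r : ℝ)⁻¹ :=
        Finset.sum_biUnion (dyadicPrimes_pairwiseDisjoint p _)
    _ ≤ ∑ j ∈ Finset.Icc 1 M, 12 * (Real.log p / p) * (j : ℝ)⁻¹ :=
        Finset.sum_le_sum fun j hj => sum_inv_dyadicPrimes_le hp (Finset.mem_Icc.1 hj).1
    _ = 12 * (Real.log p / p) * ∑ j ∈ Finset.Icc 1 M, (j : ℝ)⁻¹ := by rw [Finset.mul_sum]
    _ ≤ 12 * (Real.log p / p) * (LL n + 2) := by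
        gcongr
        linarith

lemma recipSum_le_one_add_log_div {p : ℕ} (hp : p.Prime) (n : ℕ) :
    recipSum p n ≤ (1 + Real.log n) / p := by
  have hp0 : (0 : ℝ) < p := by exact_mod_cast hp.pos
  have hsub : apPrimes p n ⊆ (Finset.Icc 1 n).image fun k => p * k + 1 := by
    intro r hr
    simp only [apPrimes, Finset.mem_filter, Finset.mem_range] at hr
    obtain ⟨hrn, hrp, hr1⟩ := hr
    obtain ⟨k, hk⟩ := (Nat.modEq_iff_dvd' hrp.one_lt.le).1 hr1.symm
    have h2 := hrp.two_le
    rw [Finset.mem_image]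
    refine ⟨k, Finset.mem_Icc.2 ⟨?_, ?_⟩, by omega⟩
    · by_contra h
      have : k = 0 := by omega
      subst this; omega
    · have := Nat.le_mul_of_pos_left k hp.pos
      omega
  have hharm : ∑ j ∈ Finset.Icc 1 n, ((j : ℝ))⁻¹ ≤ 1 + Real.log n := by
    have := harmonic_le_one_add_log n
    rw [harmonic_eq_sum_Icc] at this
    push_cast at this
    exact this
  calc recipSum p n ≤ ∑ r ∈ (Finset.Icc 1 n).image (fun k => p * k + 1), (r : ℝ)⁻¹ :=
        Finset.sum_le_sum_of_subset_of_nonneg hsub fun _ _ _ => by positivity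
    _ = ∑ k ∈ Finset.Icc 1 n, ((p * k + 1 : ℕ) : ℝ)⁻¹ := by
        refine Finset.sum_image fun a _ b _ h => ?_
        have : p * a = p * b := by simpa using h
        exact Nat.eq_of_mul_eq_mul_left hp.pos this
    _ ≤ ∑ k ∈ Finset.Icc 1 n, (p : ℝ)⁻¹ * (k : ℝ)⁻¹ := by
        refine Finset.sum_le_sum fun k hk => ?_
        have hk : (0 : ℝ) < k := by exact_mod_cast (Finset.mem_Icc.1 hk).1
        rw [← mul_inv]
        push_cast
        exact inv_anti₀ (by positivity) (by linarith)
    _ = (p : ℝ)⁻¹ * ∑ k ∈ Finset.Icc 1 n, (k : ℝ)⁻¹ := by rw [Finset.mul_sum]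
    _ ≤ (p : ℝ)⁻¹ * (1 + Real.log n) := by gcongr
    _ = _ := by ring

lemma mean_excess_le_exp {p n : ℕ} {w c : ℝ} (hw : 1 ≤ w) (hwc : 4 ≤ w * c) (hp : p.Prime)
    (hp2 : 2 < p) (hn : 3 ≤ n) (hlog : 12 * (Real.exp w - 1) * Real.log p ≤ p) :
    mean (fun m => max ((omegaQ m p : ℝ) + 2 - c * LL n) 0) n
      ≤ Real.exp (2 * w + 2 - 3 * LL n) := by
  have hL := LL_pos hn
  have hp0 : (0 : ℝ) < p := by exact_mod_cast hp.pos
  have hy : 0 ≤ Real.exp w - 1 := by linarith [Real.add_one_le_exp w]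
  have hpoint : ∀ m, 1 ≤ m → m ≤ n → max ((omegaQ m p : ℝ) + 2 - c * LL n) 0
      ≤ Real.exp (2 * w - w * c * LL n) * (1 + (Real.exp w - 1)) ^ omegaQ m p := by
    intro m _ _
    rw [add_sub_cancel, ← Real.exp_nat_mul, ← Real.exp_add]
    refine max_le ?_ (Real.exp_pos _).le
    set t : ℝ := (omegaQ m p : ℝ) + 2 - c * LL n with ht
    have he : 2 * w - w * c * LL n + omegaQ m p * w = w * t := by rw [ht]; ring
    rw [he]
    rcases le_total t 0 with h | h
    · exact h.trans (Real.exp_pos _).le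
    · nlinarith [Real.add_one_le_exp (w * t)]
  refine (mean_mono hpoint).trans ?_
  rw [mean_const_mul]
  have h1 := mean_pow_omegaQ_le p n hy
  have h2 : (Real.exp w - 1) * recipSum p n ≤ LL n + 2 := by
    have h3 := mul_le_mul_of_nonneg_left (recipSum_le_log_div hp hp2 hn) hy
    have h4 : (Real.exp w - 1) * (12 * (Real.log p / p) * (LL n + 2))
        = (12 * (Real.exp w - 1) * Real.log p) / p * (LL n + 2) := by ring
    have h5 : (12 * (Real.exp w - 1) * Real.log p) / p ≤ 1 := by rwa [div_le_one hp0]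
    rw [h4] at h3
    nlinarith
  calc _ ≤ Real.exp (2 * w - w * c * LL n) * Real.exp ((Real.exp w - 1) * recipSum p n) := by
        gcongr
    _ ≤ Real.exp (2 * w - w * c * LL n) * Real.exp (LL n + 2) := by gcongr
    _ = Real.exp (2 * w - w * c * LL n + (LL n + 2)) := (Real.exp_add _ _).symm
    _ ≤ _ := by
        rw [Real.exp_le_exp]
        nlinarith

lemma mean_excess_le_sq {p n : ℕ} {c : ℝ} (hp : p.Prime) (hcL : 3 ≤ c * LL n) :
    mean (fun m => max ((omegaQ m p : ℝ) + 2 - c * LL n) 0) n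
      ≤ (1 + Real.log n) ^ 2 * ((p : ℝ) ^ 2)⁻¹ := by
  have h1 : mean (fun m => max ((omegaQ m p : ℝ) + 2 - c * LL n) 0) n
      ≤ mean (fun m => (omegaQ m p : ℝ) * (omegaQ m p - 1)) n := by
    refine mean_mono fun m _ _ => ?_
    have hnonneg : (0 : ℝ) ≤ (omegaQ m p : ℝ) * (omegaQ m p - 1) := by
      rcases Nat.eq_zero_or_pos (omegaQ m p) with h | h
      · simp [h]
      · have : (1 : ℝ) ≤ omegaQ m p := by exact_mod_cast h
        nlinarith
    refine max_le ?_ hnonneg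
    nlinarith [sq_nonneg ((omegaQ m p : ℝ) - 1)]
  have h2 := recipSum_le_one_add_log_div hp n
  calc _ ≤ recipSum p n ^ 2 := h1.trans (mean_omegaQ_mul_pred_le p n)
    _ ≤ ((1 + Real.log n) / p) ^ 2 := by
        have := recipSum_nonneg p n
        gcongr
    _ = _ := by rw [div_pow, div_eq_mul_inv]

theorem mean_large_primes_excess_bounded {c : ℝ} (hc : 0 < c) :
    ∃ (P₀ : ℕ) (C : ℝ), ∀ n, 3 ≤ n →
      mean (fun m => ∑ p ∈ (Finset.range (n + 1)).filter (fun p => p.Prime ∧ P₀ < p),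
        max ((omegaQ m p : ℝ) + 2 - c * LL n) 0) n ≤ C := by
  set w : ℝ := max 1 (4 / c) with hw
  have hw1 : 1 ≤ w := le_max_left _ _
  have hwc : 4 ≤ w * c := by
    rw [← div_le_iff₀ hc]; exact le_max_right _ _
  have hy : 0 < 12 * (Real.exp w - 1) := by linarith [Real.add_one_le_exp w]
  obtain ⟨P₁, hP₁⟩ : ∃ P₁ : ℕ, ∀ p : ℕ, P₁ ≤ p → 12 * (Real.exp w - 1) * Real.log p ≤ p := by
    have h := (Real.isLittleO_log_id_atTop.comp_tendsto
      (tendsto_natCast_atTop_atTop (R := ℝ))).def (inv_pos.2 hy)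
    obtain ⟨P₁, h⟩ := eventually_atTop.1 h
    refine ⟨P₁, fun p hp => ?_⟩
    have := h p hp
    simp only [Function.comp, id, Real.norm_eq_abs, Nat.abs_cast] at this
    rw [inv_mul_eq_div, le_div_iff₀ hy] at this
    nlinarith [le_abs_self (Real.log p)]
  refine ⟨max 2 P₁, 4 * Real.exp (2 * w + 2) + 2
    + (Real.exp (Real.exp (3 / c)) + 1) * Real.exp (2 * w + 2), fun n hn => ?_⟩
  rw [mean_sum]
  set S := (Finset.range (n + 1)).filter (fun p => p.Prime ∧ max 2 P₁ < p) with hS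
  set F : ℕ → ℝ := fun p => mean (fun m => max ((omegaQ m p : ℝ) + 2 - c * LL n) 0) n with hF
  have hmem : ∀ p ∈ S, p ≤ n ∧ p.Prime ∧ 2 < p ∧ P₁ ≤ p := by
    intro p hp
    simp only [hS, Finset.mem_filter, Finset.mem_range, max_lt_iff] at hp
    exact ⟨by omega, hp.2.1, hp.2.2.1, hp.2.2.2.le⟩
  have hL := LL_pos hn
  have hl1 := one_lt_log_of_three_le hn
  have hexpL : Real.exp (LL n) = Real.log n := Real.exp_log (by linarith)
  have hE : 0 < Real.exp (2 * w + 2) := Real.exp_pos _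
  have hFexp : ∀ p ∈ S, F p ≤ Real.exp (2 * w + 2 - 3 * LL n) := fun p hp =>
    mean_excess_le_exp hw1 hwc (hmem p hp).2.1 (hmem p hp).2.2.1 hn (hP₁ p (hmem p hp).2.2.2)
  rcases lt_or_ge (c * LL n) 3 with hcL | hcL
  · have hn' : (n : ℝ) ≤ Real.exp (Real.exp (3 / c)) := by
      have h1 : LL n ≤ 3 / c := by rw [le_div_iff₀ hc]; linarith
      have h2 : Real.log n ≤ Real.exp (3 / c) := by rw [← hexpL]; exact Real.exp_le_exp.2 h1
      calc (n : ℝ) = Real.exp (Real.log n) := (Real.exp_log (by positivity)).symm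
        _ ≤ _ := Real.exp_le_exp.2 h2
    have hcard : (S.card : ℝ) ≤ n + 1 := by
      have := Finset.card_filter_le (Finset.range (n + 1)) (fun p => p.Prime ∧ max 2 P₁ < p)
      rw [Finset.card_range] at this
      exact_mod_cast this
    have h1 : ∑ p ∈ S, F p ≤ S.card * Real.exp (2 * w + 2) := by
      rw [← nsmul_eq_mul, ← Finset.sum_const]
      refine Finset.sum_le_sum fun p hp => (hFexp p hp).trans (Real.exp_le_exp.2 (by linarith))
    have h2 : (S.card : ℝ) * Real.exp (2 * w + 2)
        ≤ (Real.exp (Real.exp (3 / c)) + 1) * Real.exp (2 * w + 2) := by gcongr; linarith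
    linarith
  · set Y : ℝ := (1 + Real.log n) ^ 2 with hY
    set k := ⌊Y⌋₊ with hk
    have hY0 : 0 ≤ Y := by positivity
    have hlow : ∑ p ∈ S.filter (· ≤ k), F p ≤ 4 * Real.exp (2 * w + 2) := by
      have hcard : ((S.filter (· ≤ k)).card : ℝ) ≤ Y := by
        refine le_trans ?_ (Nat.floor_le hY0)
        have : S.filter (· ≤ k) ⊆ Finset.Icc 1 k := by
          intro p hp
          rw [Finset.mem_filter] at hp
          exact Finset.mem_Icc.2 ⟨(hmem p hp.1).2.1.one_lt.le, hp.2⟩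
        have := Finset.card_le_card this
        rw [Nat.card_Icc, Nat.add_sub_cancel] at this
        exact_mod_cast this
      have h1 : ∑ p ∈ S.filter (· ≤ k), F p
          ≤ (S.filter (· ≤ k)).card * Real.exp (2 * w + 2 - 3 * LL n) := by
        rw [← nsmul_eq_mul, ← Finset.sum_const]
        exact Finset.sum_le_sum fun p hp => hFexp p (Finset.mem_filter.1 hp).1
      have hYle : Y ≤ 4 * Real.exp (2 * LL n) := by
        rw [two_mul, Real.exp_add, hexpL]; nlinarith
      calc _ ≤ (4 * Real.exp (2 * LL n)) * Real.exp (2 * w + 2 - 3 * LL n) := by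
            refine h1.trans ?_
            gcongr
            exact hcard.trans hYle
        _ = 4 * Real.exp (2 * LL n + (2 * w + 2 - 3 * LL n)) := by rw [Real.exp_add]; ring
        _ ≤ _ := by
            have : 2 * LL n + (2 * w + 2 - 3 * LL n) ≤ 2 * w + 2 := by linarith
            gcongr
    have hhigh : ∑ p ∈ S.filter (fun p => ¬ p ≤ k), F p ≤ 2 := by
      have hsub : S.filter (fun p => ¬ p ≤ k) ⊆ Finset.Ioo k (n + 1) := by
        intro p hp
        rw [Finset.mem_filter] at hp
        have := (hmem p hp.1).1
        rw [Finset.mem_Ioo]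
        omega
      calc _ ≤ ∑ p ∈ S.filter (fun p => ¬ p ≤ k), Y * ((p : ℝ) ^ 2)⁻¹ :=
            Finset.sum_le_sum fun p hp =>
              mean_excess_le_sq (hmem p (Finset.mem_filter.1 hp).1).2.1 hcL
        _ ≤ ∑ p ∈ Finset.Ioo k (n + 1), Y * ((p : ℝ) ^ 2)⁻¹ :=
            Finset.sum_le_sum_of_subset_of_nonneg hsub fun _ _ _ => by positivity
        _ = Y * ∑ p ∈ Finset.Ioo k (n + 1), ((p : ℝ) ^ 2)⁻¹ := by rw [Finset.mul_sum]
        _ ≤ Y * (2 / (k + 1)) := by gcongr; exact sum_Ioo_inv_sq_le k (n + 1)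
        _ ≤ 2 := by
            have : Y < k + 1 := Nat.lt_floor_add_one Y
            rw [mul_div_assoc', div_le_iff₀ (by positivity)]
            linarith
    have := Finset.sum_filter_add_sum_filter_not S (· ≤ k) F
    have h3 : 0 ≤ (Real.exp (Real.exp (3 / c)) + 1) * Real.exp (2 * w + 2) := by positivity
    linarith

lemma zmod_prod_equiv_gcd_lcm {a b : ℕ} (ha : 0 < a) (hb : 0 < b) :
    Nonempty ((ZMod a × ZMod b) ≃+ (ZMod (Nat.gcd a b) × ZMod (Nat.lcm a b))) := by
  set g := Nat.gcd a b
  set l := Nat.lcm a b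
  have hg : 0 < g := Nat.gcd_pos_of_pos_left b ha
  have hl : 0 < l := Nat.lcm_pos ha hb
  have : NeZero a := ⟨ha.ne'⟩
  have : NeZero b := ⟨hb.ne'⟩
  have : NeZero g := ⟨hg.ne'⟩
  have : NeZero l := ⟨hl.ne'⟩
  obtain ⟨a', ha'⟩ : g ∣ a := Nat.gcd_dvd_left a b
  obtain ⟨b', hb'⟩ : g ∣ b := Nat.gcd_dvd_right a b
  obtain ⟨u, v, huv⟩ : ∃ u v : ℤ, u * a' + v * b' = 1 := by
    refine ⟨Nat.gcdA a b, Nat.gcdB a b, ?_⟩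
    have h := Nat.gcd_eq_gcd_ab a b
    have hg0 : (g : ℤ) ≠ 0 := by exact_mod_cast hg.ne'
    have h1 : (g : ℤ) = a * Nat.gcdA a b + b * Nat.gcdB a b := h
    have h2 : (a : ℤ) = g * a' := by exact_mod_cast ha'
    have h3 : (b : ℤ) = g * b' := by exact_mod_cast hb'
    refine mul_left_cancel₀ hg0 ?_
    generalize Nat.gcdA a b = x at *
    generalize Nat.gcdB a b = y at *
    linear_combination -h1 - x * h2 - y * h3
  have hza : (a : ZMod a) = 0 := ZMod.natCast_self a
  have hzb : (b : ZMod b) = 0 := ZMod.natCast_self b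
  have hza' : (g : ZMod a) * a' = 0 := by
    rw [← Nat.cast_mul, ← ha', hza]
  have hzb' : (g : ZMod b) * b' = 0 := by
    rw [← Nat.cast_mul, ← hb', hzb]
  set e₁ : ZMod a × ZMod b := ((u : ZMod a) * a', -((v : ZMod b) * b'))
  have he₁ : zmultiplesHom (ZMod a × ZMod b) e₁ (g : ℤ) = 0 := by
    ext
    · simp only [e₁, zmultiplesHom_apply, Prod.smul_fst, Prod.fst_zero]
      rw [zsmul_eq_mul]
      push_cast
      linear_combination (u : ZMod a) * hza'
    · simp only [e₁, zmultiplesHom_apply, Prod.smul_snd, Prod.snd_zero]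
      rw [zsmul_eq_mul]
      push_cast
      linear_combination -(v : ZMod b) * hzb'
  have he₂ : zmultiplesHom (ZMod a × ZMod b) 1 (l : ℤ) = 0 := by
    ext
    · simp [l]
    · simp [l]
  set f : ZMod g × ZMod l →+ ZMod a × ZMod b :=
    (ZMod.lift g ⟨_, he₁⟩).coprod (ZMod.lift l ⟨_, he₂⟩) with hf
  have hfint : ∀ x y : ℤ, f ((x : ZMod g), (y : ZMod l)) = x • e₁ + y • 1 := by
    intro x y
    rw [hf, AddMonoidHom.coprod_apply, ZMod.lift_coe, ZMod.lift_coe]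
    rfl
  have hsurj : Function.Surjective f := by
    rintro ⟨x, y⟩
    obtain ⟨x, rfl⟩ := ZMod.intCast_surjective x
    obtain ⟨y, rfl⟩ := ZMod.intCast_surjective y
    have huva : (u : ZMod a) * a' + v * b' = 1 := by exact_mod_cast congrArg (Int.cast (R := ZMod a)) huv
    have huvb : (u : ZMod b) * a' + v * b' = 1 := by exact_mod_cast congrArg (Int.cast (R := ZMod b)) huv
    refine ⟨(((x - y : ℤ) : ZMod g), ((x * (v * b') + y * (u * a') : ℤ) : ZMod l)), ?_⟩
    rw [hfint]
    ext
    · simp only [e₁, Prod.fst_add, Prod.smul_fst, Prod.fst_one]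
      rw [zsmul_eq_mul, zsmul_eq_mul]
      push_cast
      linear_combination (x : ZMod a) * huva
    · simp only [e₁, Prod.snd_add, Prod.smul_snd, Prod.snd_one]
      rw [zsmul_eq_mul, zsmul_eq_mul]
      push_cast
      linear_combination (y : ZMod b) * huvb
  have hcard : Nat.card (ZMod g × ZMod l) = Nat.card (ZMod a × ZMod b) := by
    simp only [Nat.card_prod, Nat.card_zmod]
    exact Nat.gcd_mul_lcm a b
  exact ⟨(AddEquiv.ofBijective f (hsurj.bijective_of_nat_card_le hcard.le)).symm⟩

lemma exists_chain_insert : ∀ (K : ℕ) (lam : Fin K → ℕ) (a : ℕ), 0 < a → (∀ j, 1 < lam j) →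
    (∀ j k, j ≤ k → lam j ∣ lam k) →
    ∃ (K' : ℕ) (lam' : Fin K' → ℕ), (∀ j, 1 < lam' j) ∧ (∀ j k, j ≤ k → lam' j ∣ lam' k) ∧
      (∀ D, D ∣ a → (∀ j, D ∣ lam j) → ∀ j, D ∣ lam' j) ∧
      Nonempty ((ZMod a × ∀ j, ZMod (lam j)) ≃+ ∀ j, ZMod (lam' j)) := by
  intro K
  induction K with
  | zero =>
    intro lam a ha _ _
    rcases (show 1 ≤ a from ha).eq_or_lt with rfl | h1
    · exact ⟨0, lam, fun j => j.elim0, fun j => j.elim0, fun _ _ _ j => j.elim0,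
        ⟨AddEquiv.uniqueProd⟩⟩
    · refine ⟨1, fun _ => a, fun _ => h1, fun _ _ _ => dvd_rfl, fun D h _ _ => h, ?_⟩
      exact ⟨AddEquiv.prodUnique.trans (AddEquiv.piUnique (fun _ : Fin 1 => ZMod a)).symm⟩
  | succ K ih =>
    intro lam a ha hgt hch
    have hb : 0 < lam 0 := by have := hgt 0; omega
    have hdl : ∀ j : Fin K, lam 0 ∣ lam j.succ := fun j => hch 0 j.succ (Fin.zero_le _)
    obtain ⟨K', lam', hgt', hch', hD', ⟨e'⟩⟩ := ih (fun j => lam j.succ) (Nat.lcm a (lam 0))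
      (Nat.lcm_pos ha hb) (fun j => hgt _) (fun j k hjk => hch _ _ (Fin.succ_le_succ_iff.2 hjk))
    obtain ⟨e₀⟩ := zmod_prod_equiv_gcd_lcm ha hb
    have hD : ∀ D, D ∣ a → (∀ j, D ∣ lam j) → ∀ j, D ∣ lam' j := fun D h1 h2 =>
      hD' D (h1.trans (Nat.dvd_lcm_left _ _)) (fun j => h2 _)
    have e : (ZMod a × ∀ j, ZMod (lam j)) ≃+ (ZMod (Nat.gcd a (lam 0)) × ∀ j, ZMod (lam' j)) :=
      ((AddEquiv.refl _).prodCongr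
        (Fin.consLinearEquiv ℤ fun j => ZMod (lam j)).toAddEquiv.symm).trans <|
      AddEquiv.prodAssoc.symm.trans <| (e₀.prodCongr (AddEquiv.refl _)).trans <|
      AddEquiv.prodAssoc.trans <| (AddEquiv.refl _).prodCongr e'
    have hgpos : 0 < Nat.gcd a (lam 0) := Nat.gcd_pos_of_pos_left _ ha
    rcases (show 1 ≤ Nat.gcd a (lam 0) from hgpos).eq_or_lt with h1 | h1
    · rw [← h1] at e
      exact ⟨K', lam', hgt', hch', hD, ⟨e.trans AddEquiv.uniqueProd⟩⟩
    · have hgd : ∀ j, Nat.gcd a (lam 0) ∣ lam' j :=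
        hD' _ ((Nat.gcd_dvd_left _ _).trans (Nat.dvd_lcm_left _ _))
          (fun j => (Nat.gcd_dvd_right _ _).trans (hdl j))
      refine ⟨K' + 1, Fin.cons (Nat.gcd a (lam 0)) lam', ?_, ?_, ?_, ?_⟩
      · intro j
        refine Fin.cases ?_ (fun j => ?_) j
        · simpa using h1
        · simpa using hgt' j
      · intro j k
        refine Fin.cases (fun _ => ?_) (fun j => ?_) j
        · refine Fin.cases ?_ (fun k => ?_) k
          · exact dvd_rfl
          · simpa using hgd k
        · refine Fin.cases (fun h => ?_) (fun k h => ?_) k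
          · exact absurd h (by simp)
          · simpa using hch' j k (Fin.succ_le_succ_iff.1 h)
      · intro D h1 h2 j
        refine Fin.cases ?_ (fun j => ?_) j
        · simpa using Nat.dvd_gcd h1 (h2 0)
        · simpa using hD D h1 h2 j
      · refine ⟨e.trans (Fin.consLinearEquiv ℤ fun j =>
          ZMod ((Fin.cons (Nat.gcd a (lam 0)) lam' : Fin (K' + 1) → ℕ) j)).toAddEquiv⟩

lemma exists_chain_of_pi : ∀ (n : ℕ) (f : Fin n → ℕ), (∀ j, 0 < f j) →
    ∃ (K : ℕ) (lam : Fin K → ℕ), (∀ j, 1 < lam j) ∧ (∀ j k, j ≤ k → lam j ∣ lam k) ∧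
      Nonempty ((∀ j, ZMod (f j)) ≃+ ∀ j, ZMod (lam j)) := by
  intro n
  induction n with
  | zero =>
    intro f _
    exact ⟨0, Fin.elim0, fun j => j.elim0, fun j => j.elim0, ⟨AddEquiv.ofUnique⟩⟩
  | succ n ih =>
    intro f hf
    obtain ⟨K, lam, h1, h2, ⟨e⟩⟩ := ih (fun j => f j.succ) fun j => hf _
    obtain ⟨K', lam', h1', h2', -, ⟨e'⟩⟩ := exists_chain_insert K lam (f 0) (hf 0) h1 h2
    exact ⟨K', lam', h1', h2', ⟨(Fin.consLinearEquiv ℤ fun j => ZMod (f j)).toAddEquiv.symm.trans <|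
      ((AddEquiv.refl _).prodCongr e).trans e'⟩⟩

/-- Invariant factor decomposition of a finite commutative group. -/
theorem exists_invariant_factors (G : Type*) [CommGroup G] [Finite G] :
    ∃ (K : ℕ) (lam : Fin K → ℕ), (∀ j, 1 < lam j) ∧ (∀ j k, j ≤ k → lam j ∣ lam k) ∧
      Nonempty (G ≃* Multiplicative (∀ j, ZMod (lam j))) := by
  obtain ⟨ι, _, n, hn, ⟨e⟩⟩ := CommGroup.equiv_prod_multiplicative_zmod_of_finite G
  obtain ⟨K, lam, h1, h2, ⟨e'⟩⟩ := exists_chain_of_pi (Fintype.card ι)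
    (fun j => n ((Fintype.equivFin ι).symm j)) fun j => by have := hn ((Fintype.equivFin ι).symm j); omega
  refine ⟨K, lam, h1, h2, ⟨e.trans ((MulEquiv.piMultiplicative _).symm.trans ?_)⟩⟩
  exact AddEquiv.toMultiplicative <|
    (LinearEquiv.piCongrLeft ℤ (fun i => ZMod (n i)) (Fintype.equivFin ι).symm).toAddEquiv.symm.trans e'

/-- The number of solutions of `x ^ k = 1` in a monoid. -/
def torsionCard (G : Type*) [Monoid G] (k : ℕ) : ℕ := Nat.card {x : G // x ^ k = 1}

lemma torsionCard_congr {G H : Type*} [Monoid G] [Monoid H] (e : G ≃* H) (k : ℕ) :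
    torsionCard G k = torsionCard H k := by
  refine Nat.card_congr (e.toEquiv.subtypeEquiv fun x => ?_)
  change x ^ k = 1 ↔ e x ^ k = 1
  rw [← map_pow, e.map_eq_one_iff]

lemma torsionCard_pi {ι : Type*} [Fintype ι] (G : ι → Type*) [∀ i, Monoid (G i)] (k : ℕ) :
    torsionCard (∀ i, G i) k = ∏ i, torsionCard (G i) k := by
  simp only [torsionCard]
  rw [← Nat.card_pi]
  refine Nat.card_congr (Equiv.trans (Equiv.subtypeEquivRight fun x => ?_)
    (Equiv.subtypePiEquivPi (p := fun i (y : G i) => y ^ k = 1)))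
  exact funext_iff

lemma torsionCard_of_isCyclic (G : Type*) [CommGroup G] [IsCyclic G] [Finite G] (k : ℕ) :
    torsionCard G k = (Nat.card G).gcd k := by
  rw [← IsCyclic.card_powMonoidHom_ker]
  rfl

lemma torsionCard_pos (G : Type*) [Monoid G] [Finite G] (k : ℕ) : 0 < torsionCard G k := by
  have : Nonempty {x : G // x ^ k = 1} := ⟨⟨1, one_pow k⟩⟩
  exact Nat.card_pos

lemma torsionCard_le_of_dvd (G : Type*) [Monoid G] [Finite G] {k l : ℕ} (h : k ∣ l) :
    torsionCard G k ≤ torsionCard G l := by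
  refine Nat.card_le_card_of_injective
    (fun x : {x : G // x ^ k = 1} => (⟨x.1, ?_⟩ : {x : G // x ^ l = 1})) fun x y h => ?_
  · obtain ⟨c, rfl⟩ := h
    rw [pow_mul, x.2, one_pow]
  · simpa [Subtype.ext_iff] using h

lemma torsionCard_mul_le (G : Type*) [CommGroup G] [Finite G] (k l : ℕ) :
    torsionCard G (k * l) ≤ torsionCard G k * torsionCard G l := by
  classical
  have := Fintype.ofFinite G
  have hT : ∀ j, torsionCard G j = (Finset.univ.filter fun x : G => x ^ j = 1).card := fun j => by
    rw [torsionCard, Nat.card_eq_fintype_card, Fintype.card_subtype]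
  rw [hT, hT, hT]
  refine Finset.card_le_mul_card_image_of_maps_to (f := fun x => x ^ k) ?_ _ ?_
  · intro x hx
    simpa [← pow_mul] using hx
  · intro b _
    rcases Finset.eq_empty_or_nonempty
      ((Finset.univ.filter fun x : G => x ^ (k * l) = 1).filter fun a => a ^ k = b) with h | ⟨x₀, h⟩
    · rw [h]; simp
    · refine Finset.card_le_card_of_injOn (fun x => x * x₀⁻¹) (fun x hx => ?_)
        (fun x _ y _ hxy => mul_right_cancel hxy)
      have h1 := (Finset.mem_filter.1 h).2
      have h2 := (Finset.mem_filter.1 hx).2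
      simp [mul_pow, h1, h2]

lemma gcd_pow_succ {p : ℕ} (hp : p.Prime) (a N : ℕ) :
    N.gcd (p ^ (a + 1)) = N.gcd (p ^ a) * if p ^ (a + 1) ∣ N then p else 1 := by
  split_ifs with h
  · rw [Nat.gcd_eq_right h, Nat.gcd_eq_right ((pow_dvd_pow p (Nat.le_succ a)).trans h), pow_succ]
  · rw [mul_one]
    refine Nat.dvd_antisymm (Nat.dvd_gcd (Nat.gcd_dvd_left _ _) ?_)
      (Nat.gcd_dvd_gcd_of_dvd_right _ (pow_dvd_pow p (Nat.le_succ a)))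
    obtain ⟨b, hb, hb'⟩ := (Nat.dvd_prime_pow hp).1 (Nat.gcd_dvd_right N (p ^ (a + 1)))
    rw [hb']
    refine pow_dvd_pow p (Nat.lt_succ_iff.1 (lt_of_le_of_ne hb ?_))
    rintro rfl
    exact h (hb' ▸ Nat.gcd_dvd_left _ _)

lemma torsionCard_pi_zmod {K : ℕ} (lam : Fin K → ℕ) (hlam : ∀ j, 1 < lam j) {p : ℕ}
    (hp : p.Prime) (a : ℕ) :
    torsionCard (Multiplicative (∀ j, ZMod (lam j))) (p ^ (a + 1))
      = torsionCard (Multiplicative (∀ j, ZMod (lam j))) (p ^ a) *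
        p ^ (Finset.univ.filter fun j => p ^ (a + 1) ∣ lam j).card := by
  have hfac : ∀ k, torsionCard (Multiplicative (∀ j, ZMod (lam j))) k = ∏ j, (lam j).gcd k := by
    intro k
    rw [torsionCard_congr (MulEquiv.piMultiplicative _), torsionCard_pi]
    refine Finset.prod_congr rfl fun j _ => ?_
    have : NeZero (lam j) := ⟨by have := hlam j; omega⟩
    rw [torsionCard_of_isCyclic]
    simp
  rw [hfac, hfac, Finset.card_filter, ← Finset.prod_pow_eq_pow_sum, ← Finset.prod_mul_distrib]
  refine Finset.prod_congr rfl fun j _ => ?_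
  rw [gcd_pow_succ hp]
  split_ifs <;> simp

lemma intCast_eq_or_eq_add_two_pow {R : Type*} [CommRing R] {k : ℕ} (h2k : (2 : R) ^ (k + 1) = 0)
    {s X : ℤ} (h : (2 : ℤ) ^ k ∣ X - s) : (X : R) = s ∨ (X : R) = s + 2 ^ k := by
  obtain ⟨t, ht⟩ := h
  have hX : X = s + 2 ^ k * t := by linarith
  rcases Int.even_or_odd' t with ⟨u, rfl | rfl⟩
  · left
    rw [hX]; push_cast
    linear_combination (u : R) * h2k
  · right
    rw [hX]; push_cast
    linear_combination (u : R) * h2k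

lemma torsionCard_units_two_pow (e : ℕ) : torsionCard (ZMod (2 ^ e))ˣ 2 ≤ 4 := by
  classical
  rcases e with _ | k
  · have : Subsingleton (ZMod (2 ^ 0)) := by rw [pow_zero]; infer_instance
    have : Nat.card {x : (ZMod (2 ^ 0))ˣ // x ^ 2 = 1} ≤ 1 := Finite.card_le_one_iff_subsingleton.2 inferInstance
    exact this.trans (by norm_num)
  set R := ZMod (2 ^ (k + 1))
  set S : Finset R := {1, 1 + 2 ^ k, -1, -1 + 2 ^ k}
  have h2k : (2 : R) ^ (k + 1) = 0 := by
    have := ZMod.natCast_self (2 ^ (k + 1))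
    exact_mod_cast this
  have key := fun (s X : ℤ) (h : (2 : ℤ) ^ k ∣ X - s) => intCast_eq_or_eq_add_two_pow h2k h
  have hmem : ∀ x : Rˣ, x ^ 2 = 1 → (x : R) ∈ S := by
    intro x hx
    obtain ⟨X, hX⟩ := ZMod.intCast_surjective (x : R)
    have hsq : ((X ^ 2 - 1 : ℤ) : R) = 0 := by
      have := congrArg Units.val hx
      push_cast at this ⊢
      rw [hX, this, sub_self]
    have hdvd : (2 : ℤ) ^ (k + 1) ∣ X ^ 2 - 1 := by
      have := (ZMod.intCast_zmod_eq_zero_iff_dvd _ _).1 hsq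
      exact_mod_cast this
    have hodd : Odd X := by
      by_contra h
      rw [Int.not_odd_iff_even] at h
      have h2 : (2 : ℤ) ∣ X ^ 2 - 1 := (dvd_pow_self 2 (Nat.succ_ne_zero k)).trans hdvd
      obtain ⟨y, rfl⟩ := h
      obtain ⟨z, hz⟩ := h2
      ring_nf at hz
      omega
    obtain ⟨y, rfl⟩ := hodd
    have hd : (2 : ℤ) ^ (k + 1) ∣ 2 ^ (k + 1) * 0 + 2 * (2 * (y * (y + 1))) := by
      convert hdvd using 1; ring
    have hd' : (2 : ℤ) ^ k ∣ 2 * (y * (y + 1)) := by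
      rw [mul_zero, zero_add, pow_succ'] at hd
      exact Int.dvd_of_mul_dvd_mul_left two_ne_zero hd
    have hcase : (2 : ℤ) ^ k ∣ (2 * y + 1) - 1 ∨ (2 : ℤ) ^ k ∣ (2 * y + 1) - (-1) := by
      rcases Int.even_or_odd y with hy | hy
      · left
        have hc : IsCoprime ((2 : ℤ) ^ k) (y + 1) :=
          IsCoprime.pow_left (by
            obtain ⟨u, rfl⟩ := hy
            exact ⟨-u, 1, by ring⟩)
        have := hc.dvd_of_dvd_mul_right (by rwa [← mul_assoc] at hd')
        simpa using this
      · right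
        have hc : IsCoprime ((2 : ℤ) ^ k) y :=
          IsCoprime.pow_left (by
            obtain ⟨u, rfl⟩ := hy
            exact ⟨-u, 1, by ring⟩)
        rw [show 2 * (y * (y + 1)) = (2 * (y + 1)) * y by ring] at hd'
        rw [show 2 * y + 1 - -1 = 2 * (y + 1) by ring]
        exact hc.dvd_of_dvd_mul_right hd'
    simp only [S, Finset.mem_insert, Finset.mem_singleton]
    rw [← hX]
    rcases hcase with h | h
    · rcases key 1 _ h with h | h <;> simp [h]
    · rcases key (-1) _ h with h | h <;> simp [h]
  calc torsionCard Rˣ 2 ≤ Nat.card S :=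
        Nat.card_le_card_of_injective (fun x => (⟨(x.1 : R), hmem x.1 x.2⟩ : S)) fun x y h =>
          Subtype.ext (Units.ext (congrArg Subtype.val h))
    _ = S.card := by simp
    _ ≤ 4 := Finset.card_le_four

lemma primePow_dvd_pred_iff {r q : ℕ} (hr : 1 ≤ r) : q ∣ r - 1 ↔ r % q = 1 % q :=
  (Nat.modEq_iff_dvd' hr).symm.trans eq_comm

lemma torsionCard_units_primePow_of_ne {r p : ℕ} (hr : r.Prime) (hp : p.Prime) (hrp : r ≠ p)
    {e : ℕ} (he : 0 < e) (a : ℕ) :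
    torsionCard (ZMod (r ^ e))ˣ (p ^ (a + 1)) = torsionCard (ZMod (r ^ e))ˣ (p ^ a) *
      if r % p ^ (a + 1) = 1 % p ^ (a + 1) then p else 1 := by
  have : NeZero (r ^ e) := ⟨pow_ne_zero _ hr.ne_zero⟩
  have hcard : Nat.card (ZMod (r ^ e))ˣ = r ^ (e - 1) * (r - 1) := by
    rw [Nat.card_eq_fintype_card, ZMod.card_units_eq_totient, Nat.totient_prime_pow hr he]
  by_cases h2 : r = 2
  · subst h2
    have htriv : ∀ j, torsionCard (ZMod (2 ^ e))ˣ (p ^ j) = 1 := by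
      intro j
      refine Nat.card_eq_one_iff_unique.2 ⟨⟨fun x y => ?_⟩, ⟨⟨1, one_pow _⟩⟩⟩
      have key : ∀ z : (ZMod (2 ^ e))ˣ, z ^ p ^ j = 1 → z = 1 := by
        intro z hz
        have h1 := orderOf_dvd_of_pow_eq_one hz
        have h3 := orderOf_dvd_natCard z
        rw [hcard, Nat.add_sub_cancel (n := 1) (m := 1), mul_one] at h3
        have hc : Nat.Coprime (p ^ j) (2 ^ (e - 1)) :=
          Nat.Coprime.pow _ _ ((Nat.coprime_primes hp hr).2 hrp.symm)
        exact orderOf_eq_one_iff.1 (Nat.eq_one_of_dvd_coprimes hc h1 h3)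
      exact Subtype.ext ((key _ x.2).trans (key _ y.2).symm)
    have hp2 : 2 < p := lt_of_le_of_ne hp.two_le hrp
    have : ¬ p ^ (a + 1) ∣ 2 - 1 := by
      intro h
      have := Nat.le_of_dvd one_pos h
      have := Nat.le_self_pow (show a + 1 ≠ 0 by omega) p
      omega
    rw [primePow_dvd_pred_iff hr.one_lt.le] at this
    rw [htriv, htriv, if_neg this]
  · have := ZMod.isCyclic_units_of_prime_pow r hr h2 e
    rw [torsionCard_of_isCyclic, torsionCard_of_isCyclic, gcd_pow_succ hp, hcard]
    congr 1
    refine if_congr ?_ rfl rfl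
    rw [← primePow_dvd_pred_iff hr.one_lt.le]
    exact (Nat.Coprime.pow _ _ ((Nat.coprime_primes hp hr).2 hrp.symm)).dvd_mul_left

lemma torsionCard_units_primePow_self_le {p : ℕ} (hp : p.Prime) (e a : ℕ) :
    torsionCard (ZMod (p ^ e))ˣ (p ^ (a + 1)) ≤ torsionCard (ZMod (p ^ e))ˣ (p ^ a) * p ^ 2 := by
  have : NeZero (p ^ e) := ⟨pow_ne_zero _ hp.ne_zero⟩
  have hle : torsionCard (ZMod (p ^ e))ˣ p ≤ p ^ 2 := by
    by_cases h2 : p = 2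
    · subst h2; exact torsionCard_units_two_pow e
    · have := ZMod.isCyclic_units_of_prime_pow p hp h2 e
      rw [torsionCard_of_isCyclic]
      exact (Nat.le_of_dvd hp.pos (Nat.gcd_dvd_right _ _)).trans (Nat.le_self_pow two_ne_zero p)
  rw [pow_succ]
  exact (torsionCard_mul_le _ _ _).trans (Nat.mul_le_mul_left _ hle)

lemma torsionCard_units_bounds {m : ℕ} (hm : m ≠ 0) {p : ℕ} (hp : p.Prime) (a : ℕ) :
    torsionCard (ZMod m)ˣ (p ^ a) * p ^ omegaQ m (p ^ (a + 1))
        ≤ torsionCard (ZMod m)ˣ (p ^ (a + 1)) ∧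
      torsionCard (ZMod m)ˣ (p ^ (a + 1))
        ≤ torsionCard (ZMod m)ˣ (p ^ a) * p ^ (omegaQ m (p ^ (a + 1)) + 2) := by
  have hfac : ∀ k, torsionCard (ZMod m)ˣ k
      = ∏ r ∈ m.primeFactors, torsionCard (ZMod (r ^ m.factorization r))ˣ k := by
    intro k
    rw [torsionCard_congr ((Units.mapEquiv (ZMod.equivPi m hm).toMulEquiv).trans MulEquiv.piUnits),
      torsionCard_pi]
    exact Finset.prod_coe_sort m.primeFactors
      fun r => torsionCard (ZMod (r ^ m.factorization r))ˣ k
  have homega : p ^ omegaQ m (p ^ (a + 1)) = ∏ r ∈ m.primeFactors,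
      if r % p ^ (a + 1) = 1 % p ^ (a + 1) then p else 1 := by
    rw [omegaQ, Finset.card_filter, ← Finset.prod_pow_eq_pow_sum]
    refine Finset.prod_congr rfl fun r _ => ?_
    split_ifs <;> simp
  have hself : ¬ p % p ^ (a + 1) = 1 % p ^ (a + 1) := by
    rw [← primePow_dvd_pred_iff hp.one_lt.le]
    intro h
    have h1 := (dvd_pow_self p (Nat.succ_ne_zero a)).trans h
    have := Nat.le_of_dvd (Nat.sub_pos_of_lt hp.one_lt) h1
    have := hp.pos
    omega
  rw [pow_add p (omegaQ m (p ^ (a + 1))) 2, homega, hfac, hfac]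
  constructor
  · rw [← Finset.prod_mul_distrib]
    refine Finset.prod_le_prod' fun r hr => ?_
    have hrp := Nat.prime_of_mem_primeFactors hr
    have : NeZero (r ^ m.factorization r) := ⟨pow_ne_zero _ hrp.ne_zero⟩
    by_cases h : r = p
    · subst h
      rw [if_neg hself, mul_one]
      exact torsionCard_le_of_dvd _ (pow_dvd_pow r (Nat.le_succ a))
    · exact (torsionCard_units_primePow_of_ne hrp hp h
        (hrp.factorization_pos_of_dvd hm (Nat.dvd_of_mem_primeFactors hr)) a).ge
  · have hp2 : ∏ r ∈ m.primeFactors, (if r = p then p ^ 2 else 1) ≤ p ^ 2 := by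
      rw [Finset.prod_ite_eq']
      split_ifs
      · exact le_rfl
      · exact Nat.one_le_pow _ _ hp.pos
    refine le_trans ?_ (Nat.mul_le_mul_left _ (Nat.mul_le_mul_left _ hp2))
    rw [← Finset.prod_mul_distrib, ← Finset.prod_mul_distrib]
    refine Finset.prod_le_prod' fun r hr => ?_
    have hrp := Nat.prime_of_mem_primeFactors hr
    by_cases h : r = p
    · subst h
      rw [if_neg hself, if_pos rfl, one_mul]
      exact torsionCard_units_primePow_self_le hp _ a
    · rw [if_neg h, mul_one]
      exact (torsionCard_units_primePow_of_ne hrp hp h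
        (hrp.factorization_pos_of_dvd hm (Nat.dvd_of_mem_primeFactors hr)) a).le

/-- The number of invariant factors divisible by a prime power `q` is `ω(m;q,1)` up to `2`. -/
theorem omegaQ_le_card_dvd_le {m : ℕ} (hm : 1 ≤ m) {K : ℕ} {lam : Fin K → ℕ}
    (hlam : ∀ j, 1 < lam j) (e : (ZMod m)ˣ ≃* Multiplicative (∀ j, ZMod (lam j))) {q : ℕ}
    (hq : IsPrimePow q) :
    omegaQ m q ≤ (Finset.univ.filter fun j => q ∣ lam j).card ∧
      (Finset.univ.filter fun j => q ∣ lam j).card ≤ omegaQ m q + 2 := by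
  obtain ⟨p, a, hp, ha, rfl⟩ := (isPrimePow_nat_iff q).1 hq
  obtain ⟨a, rfl⟩ := Nat.exists_eq_succ_of_ne_zero ha.ne'
  have : NeZero m := ⟨by omega⟩
  obtain ⟨h1, h2⟩ := torsionCard_units_bounds (m := m) (by omega) hp a
  have h3 := torsionCard_pi_zmod lam hlam hp a
  rw [← torsionCard_congr e, ← torsionCard_congr e] at h3
  rw [h3] at h1 h2
  have hpos := torsionCard_pos (ZMod m)ˣ (p ^ a)
  exact ⟨(Nat.pow_le_pow_iff_right hp.one_lt).1 (Nat.le_of_mul_le_mul_left h1 hpos),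
    (Nat.pow_le_pow_iff_right hp.one_lt).1 (Nat.le_of_mul_le_mul_left h2 hpos)⟩

lemma IsPrimePow.totient_lt_of_dvd_of_ne {q r : ℕ} (hq : IsPrimePow q) (hr : IsPrimePow r)
    (h : q ∣ r) (hne : q ≠ r) : q.totient < r.totient := by
  obtain ⟨p, b, hp, hb, rfl⟩ := (isPrimePow_nat_iff r).1 hr
  obtain ⟨a, hab, rfl⟩ := (Nat.dvd_prime_pow hp).1 h
  have ha : 0 < a := Nat.pos_of_ne_zero fun h0 => by
    subst h0; exact hq.ne_one (pow_zero p)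
  have hlt : a < b := lt_of_le_of_ne hab fun h => hne (by rw [h])
  rw [Nat.totient_prime_pow hp ha, Nat.totient_prime_pow hp hb]
  exact Nat.mul_lt_mul_of_pos_right (Nat.pow_lt_pow_right hp.one_lt (by omega))
    (Nat.sub_pos_of_lt hp.one_lt)

lemma IsPrimePow.le_two_mul_totient {q : ℕ} (hq : IsPrimePow q) : q ≤ 2 * q.totient := by
  obtain ⟨p, a, hp, ha, rfl⟩ := (isPrimePow_nat_iff q).1 hq
  obtain ⟨a, rfl⟩ := Nat.exists_eq_succ_of_ne_zero ha.ne'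
  rw [Nat.totient_prime_pow hp ha, Nat.succ_sub_one, Nat.succ_eq_add_one, pow_succ,
    mul_left_comm]
  refine Nat.mul_le_mul_left _ ?_
  have := hp.two_le
  omega

lemma IsPrimePow.dvd_lcm_iff {q : ℕ} (hq : IsPrimePow q) {a b : ℕ} (ha : a ≠ 0) (hb : b ≠ 0) :
    q ∣ Nat.lcm a b ↔ q ∣ a ∨ q ∣ b := by
  obtain ⟨p, k, hp, -, rfl⟩ := (isPrimePow_nat_iff q).1 hq
  rw [hp.pow_dvd_iff_le_factorization (Nat.lcm_ne_zero ha hb),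
    hp.pow_dvd_iff_le_factorization ha, hp.pow_dvd_iff_le_factorization hb,
    Nat.factorization_lcm ha hb, Finsupp.sup_apply, le_sup_iff]

lemma IsPrimePow.dvd_finset_lcm {ι : Type*} {q : ℕ} (hq : IsPrimePow q) {s : Finset ι} {f : ι → ℕ}
    (hf : ∀ i ∈ s, f i ≠ 0) (h : q ∣ s.lcm f) : ∃ i ∈ s, q ∣ f i := by
  classical
  induction s using Finset.induction_on with
  | empty => exact absurd (Nat.dvd_one.1 (by simpa using h)) hq.ne_one
  | insert a s _ ih =>
    rw [Finset.lcm_insert] at h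
    have hs : s.lcm f ≠ 0 := by
      rw [Ne, Finset.lcm_eq_zero_iff]
      rintro ⟨i, hi, h0⟩
      exact hf i (Finset.mem_insert_of_mem hi) h0
    rcases (hq.dvd_lcm_iff (hf a (Finset.mem_insert_self _ _)) hs).1 h with h | h
    · exact ⟨a, Finset.mem_insert_self _ _, h⟩
    · obtain ⟨i, hi, h⟩ := ih (fun i hi => hf i (Finset.mem_insert_of_mem hi)) h
      exact ⟨i, Finset.mem_insert_of_mem hi, h⟩

lemma ppKey_lt_of_totient_lt {q r : ℕ} (hq : IsPrimePow q) (h : q.totient < r.totient) :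
    ppKey q < ppKey r := by
  have := hq.le_two_mul_totient
  unfold ppKey
  nlinarith

lemma totient_le_of_ppKey_le {q r : ℕ} (hr : IsPrimePow r) (h : ppKey q ≤ ppKey r) :
    q.totient ≤ r.totient :=
  not_lt.1 fun hlt => (ppKey_lt_of_totient_lt hr hlt).not_ge h

lemma ppKey_inj {q r : ℕ} (hq : IsPrimePow q) (hr : IsPrimePow r) (h : ppKey q = ppKey r) :
    q = r := by
  have := le_antisymm (totient_le_of_ppKey_le hr h.le) (totient_le_of_ppKey_le hq h.ge)
  unfold ppKey at h
  rw [this] at h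
  omega

lemma infinite_ppKey : {k | ∃ q : ℕ, IsPrimePow q ∧ ppKey q = k}.Infinite := by
  refine Set.infinite_of_injOn_mapsTo (f := ppKey) (s := {q | IsPrimePow q})
    (fun a ha b hb h => ppKey_inj ha hb h) (fun q hq => ⟨q, hq, rfl⟩) ?_
  exact Nat.infinite_setOfPred_prime.mono fun p hp => Nat.Prime.isPrimePow hp

lemma qt_spec (i : ℕ) : IsPrimePow (qt i) ∧ ppKey (qt i) = ppNthKey (i - 1) :=
  Nat.sInf_mem (Nat.nth_mem_of_infinite infinite_ppKey (i - 1))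

lemma ppKey_qt_lt {i j : ℕ} (hi : 1 ≤ i) (h : i < j) : ppKey (qt i) < ppKey (qt j) := by
  rw [(qt_spec i).2, (qt_spec j).2]
  exact Nat.nth_strictMono infinite_ppKey (by omega)

lemma totient_qt_le {i j : ℕ} (hi : 1 ≤ i) (h : i ≤ j) : (qt i).totient ≤ (qt j).totient := by
  rcases h.eq_or_lt with rfl | h
  · exact le_rfl
  · exact totient_le_of_ppKey_le (qt_spec j).1 (ppKey_qt_lt hi h).le

lemma exists_qt_eq {q : ℕ} (hq : IsPrimePow q) : ∃ i, 1 ≤ i ∧ qt i = q := by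
  classical
  refine ⟨Nat.count (fun k => ∃ q : ℕ, IsPrimePow q ∧ ppKey q = k) (ppKey q) + 1,
    Nat.le_add_left _ _, ppKey_inj (qt_spec _).1 hq ?_⟩
  rw [(qt_spec _).2, Nat.add_sub_cancel, ppNthKey]
  exact Nat.nth_count (p := fun k => ∃ q : ℕ, IsPrimePow q ∧ ppKey q = k) ⟨q, hq, rfl⟩

lemma Lseq_ne_zero (i : ℕ) : Lseq i ≠ 0 := by
  rw [Lseq, Ne, Finset.lcm_eq_zero_iff]
  rintro ⟨j, -, h⟩
  exact (qt_spec j).1.ne_zero h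

lemma exists_dvd_qt_of_dvd_Lseq {i q : ℕ} (hq : IsPrimePow q) (h : q ∣ Lseq i) :
    ∃ j, 1 ≤ j ∧ j ≤ i ∧ q ∣ qt j := by
  obtain ⟨j, hj, h⟩ := hq.dvd_finset_lcm (fun j _ => (qt_spec j).1.ne_zero) h
  rw [Finset.mem_Icc] at hj
  exact ⟨j, hj.1, hj.2, h⟩

lemma qt_dvd_Lseq {i j : ℕ} (hj : 1 ≤ j) (h : j ≤ i) : qt j ∣ Lseq i :=
  Finset.dvd_lcm (Finset.mem_Icc.2 ⟨hj, h⟩)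

lemma totient_qt_lt_of_ncard_UFO {k : ℕ} (hk : 1 ≤ k) (h : (UFO k).ncard = 1) :
    (qt k).totient < (qt (k + 1)).totient := by
  by_contra hlt
  rw [UFO, if_neg hlt] at h
  have heq : Lseq k = Nat.lcm (Lseq (k - 1)) (qt (k + 1)) := by
    by_contra hne
    rw [Set.ncard_pair hne] at h
    omega
  have hpk := (qt_spec k).1
  have key : ∀ j, 1 ≤ j → (j < k ∨ j = k + 1) → ¬ qt k ∣ qt j := by
    intro j hj hjk hd
    have hne : qt k ≠ qt j := by
      intro h
      rcases hjk with hjk | rfl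
      · exact (ppKey_qt_lt hj hjk).ne (by rw [h])
      · exact (ppKey_qt_lt hk (Nat.lt_succ_self k)).ne (by rw [h])
    have hlt' := hpk.totient_lt_of_dvd_of_ne (qt_spec j).1 hd hne
    rcases hjk with hjk | rfl
    · exact hlt'.not_ge (totient_qt_le hj hjk.le)
    · exact hlt hlt'
  have hd : qt k ∣ Nat.lcm (Lseq (k - 1)) (qt (k + 1)) := heq ▸ qt_dvd_Lseq hk le_rfl
  rcases (hpk.dvd_lcm_iff (Lseq_ne_zero _) (qt_spec _).1.ne_zero).1 hd with hd | hd
  · obtain ⟨j, h1, h2, hj⟩ := exists_dvd_qt_of_dvd_Lseq hpk hd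
    exact key j h1 (Or.inl (by omega)) hj
  · exact key (k + 1) (by omega) (Or.inr rfl) hd

lemma dvd_Lseq_iff {i j : ℕ} (hi : 1 ≤ i) (hlt : (qt i).totient < (qt (i + 1)).totient)
    (hj : 1 ≤ j) : qt j ∣ Lseq i ↔ j ≤ i := by
  refine ⟨fun h => ?_, fun h => qt_dvd_Lseq hj h⟩
  obtain ⟨k, hk1, hki, hd⟩ := exists_dvd_qt_of_dvd_Lseq (qt_spec j).1 h
  by_contra hji
  have h1 := Nat.le_of_dvd (Nat.totient_pos.2 (qt_spec k).1.pos) (Nat.totient_dvd_of_dvd hd)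
  have h2 := totient_qt_le hk1 hki
  have h3 := totient_qt_le (show 1 ≤ i + 1 by omega) (show i + 1 ≤ j by omega)
  omega

/-- When three consecutive universal factor order sets are singletons, `q̃_i` has the strictly
largest totient among the prime powers dividing `d`, and `q̃_{i+1}` the strictly smallest among
those not dividing `d`. -/
lemma totient_qt_extremal {i : ℕ} (hi : 2 ≤ i) (h1 : (UFO (i - 1)).ncard = 1)
    (h2 : (UFO i).ncard = 1) (h3 : (UFO (i + 1)).ncard = 1) {d : ℕ} (hd : UFO i = {d}) :
    d ≠ 0 ∧ qt i ∣ d ∧ ¬ qt (i + 1) ∣ d ∧ (qt i).totient < (qt (i + 1)).totient ∧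
      (∀ q, IsPrimePow q → q ∣ d → q ≠ qt i → q.totient < (qt i).totient) ∧
      (∀ q, IsPrimePow q → ¬ q ∣ d → q ≠ qt (i + 1) → (qt (i + 1)).totient < q.totient) := by
  have l1 := totient_qt_lt_of_ncard_UFO (by omega) h1
  have l2 := totient_qt_lt_of_ncard_UFO (by omega) h2
  have l3 := totient_qt_lt_of_ncard_UFO (by omega) h3
  rw [show i - 1 + 1 = i by omega] at l1
  have hdL : Lseq i = d := by
    rw [UFO, if_pos l2] at hd
    exact Set.singleton_injective hd
  subst hdL
  refine ⟨Lseq_ne_zero i, qt_dvd_Lseq (by omega) le_rfl, ?_, l2, ?_, ?_⟩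
  · rw [dvd_Lseq_iff (by omega) l2 (by omega)]
    omega
  · intro q hq hqd hne
    obtain ⟨j, hj, rfl⟩ := exists_qt_eq hq
    rw [dvd_Lseq_iff (by omega) l2 hj] at hqd
    have hji : j ≠ i := fun h => hne (by rw [h])
    exact (totient_qt_le hj (show j ≤ i - 1 by omega)).trans_lt l1
  · intro q hq hqd hne
    obtain ⟨j, hj, rfl⟩ := exists_qt_eq hq
    rw [dvd_Lseq_iff (by omega) l2 hj] at hqd
    have hji : j ≠ i + 1 := fun h => hne (by rw [h])
    exact l3.trans_le (totient_qt_le (by omega) (show i + 1 + 1 ≤ j by omega))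

/-- The number of terms of a family divisible by `q`. -/
def dvdCount {K : ℕ} (lam : Fin K → ℕ) (q : ℕ) : ℕ :=
  (Finset.univ.filter fun j => q ∣ lam j).card

section Chain

variable {K : ℕ} {lam : Fin K → ℕ}

lemma card_dvd_not_dvd_le (hch : ∀ j k, j ≤ k → lam j ∣ lam k) (a b : ℕ) :
    ((Finset.univ.filter fun j => a ∣ lam j ∧ ¬ b ∣ lam j).card : ℝ)
      ≤ max ((dvdCount lam a : ℝ) - dvdCount lam b) 0 := by
  rcases Finset.eq_empty_or_nonempty
    (Finset.univ.filter fun j => a ∣ lam j ∧ ¬ b ∣ lam j) with h | ⟨j₀, h⟩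
  · rw [h]; simp
  · obtain ⟨ha, hb⟩ := (Finset.mem_filter.1 h).2
    have hsub : (Finset.univ.filter fun j => b ∣ lam j) ⊆ Finset.univ.filter fun j => a ∣ lam j := by
      intro j hj
      rw [Finset.mem_filter] at hj ⊢
      rcases le_total j j₀ with hle | hle
      · exact absurd (hj.2.trans (hch _ _ hle)) hb
      · exact ⟨hj.1, ha.trans (hch _ _ hle)⟩
    have heq : (Finset.univ.filter fun j => a ∣ lam j ∧ ¬ b ∣ lam j)
        = (Finset.univ.filter fun j => a ∣ lam j) \ Finset.univ.filter fun j => b ∣ lam j := by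
      ext j; simp
    rw [heq, Finset.card_sdiff_of_subset hsub, Nat.cast_sub (Finset.card_le_card hsub)]
    exact le_max_left _ _

lemma card_eq_le (hch : ∀ j k, j ≤ k → lam j ∣ lam k) {d Q Q' : ℕ} (hQ : Q ∣ d) (hQ' : ¬ Q' ∣ d) :
    ((Finset.univ.filter fun j => lam j = d).card : ℝ)
      ≤ max ((dvdCount lam Q : ℝ) - dvdCount lam Q') 0 := by
  refine le_trans ?_ (card_dvd_not_dvd_le hch Q Q')
  refine Nat.cast_le.2 (Finset.card_le_card fun j hj => ?_)
  rw [Finset.mem_filter] at hj ⊢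
  rw [hj.2]
  exact ⟨hj.1, hQ, hQ'⟩

lemma eq_of_primePow_dvd {N d Q Q' P₀ : ℕ} (hd : d ≠ 0) {D F : Finset ℕ}
    (hD : ∀ q, IsPrimePow q → q ∣ d → q ≠ Q → q ∈ D)
    (hF : ∀ q, IsPrimePow q → ¬ q ∣ d → q ≠ Q' → q ≤ d * P₀ → q ∈ F)
    (h1 : Q ∣ N) (h2 : ¬ Q' ∣ N) (h3 : ∀ q ∈ D, q ∣ N) (h4 : ∀ q ∈ F, ¬ q ∣ N)
    (h5 : ∀ p : ℕ, p.Prime → P₀ < p → ¬ p ∣ N) : N = d := by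
  refine Nat.dvd_antisymm ?_ ?_
  · rw [Nat.dvd_iff_prime_pow_dvd_dvd]
    intro p k hp hk
    by_contra hkd
    have hk0 : k ≠ 0 := by rintro rfl; exact hkd (by simp)
    have hpP : p ≤ P₀ := not_lt.1 fun h => h5 p hp h ((dvd_pow_self p hk0).trans hk)
    set v := d.factorization p
    have hvk : v + 1 ≤ k := by
      by_contra hlt
      exact hkd ((pow_dvd_pow p (by omega)).trans (Nat.ordProj_dvd d p))
    have hqN : p ^ (v + 1) ∣ N := (pow_dvd_pow p hvk).trans hk
    refine h4 _ (hF _ (hp.isPrimePow.pow (Nat.succ_ne_zero v))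
      (Nat.pow_succ_factorization_not_dvd hd hp) ?_ ?_) hqN
    · rintro h
      exact h2 (h ▸ hqN)
    · rw [pow_succ]
      exact Nat.mul_le_mul (Nat.le_of_dvd (Nat.pos_of_ne_zero hd) (Nat.ordProj_dvd d p)) hpP
  · rw [Nat.dvd_iff_prime_pow_dvd_dvd]
    intro p k hp hk
    rcases Nat.eq_zero_or_pos k with rfl | hk0
    · simp
    · by_cases h : p ^ k = Q
      · exact h ▸ h1
      · exact h3 _ (hD _ (hp.isPrimePow.pow hk0.ne') hk h)

lemma dvdCount_le_card_eq_add (hch : ∀ j k, j ≤ k → lam j ∣ lam k)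
    {d Q Q' P₀ : ℕ} (hd : d ≠ 0) {D F : Finset ℕ}
    (hD : ∀ q, IsPrimePow q → q ∣ d → q ≠ Q → q ∈ D)
    (hF : ∀ q, IsPrimePow q → ¬ q ∣ d → q ≠ Q' → q ≤ d * P₀ → q ∈ F) {B : ℝ} (hB : 0 ≤ B)
    (hlarge : ∀ p : ℕ, p.Prime → P₀ < p → (∃ j, p ∣ lam j) →
      (dvdCount lam p : ℝ) - dvdCount lam Q' ≤ B) :
    (dvdCount lam Q : ℝ) ≤ (Finset.univ.filter fun j => lam j = d).card + dvdCount lam Q'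
      + ∑ q ∈ D, max ((dvdCount lam Q : ℝ) - dvdCount lam q) 0
      + ∑ q ∈ F, max ((dvdCount lam q : ℝ) - dvdCount lam Q') 0 + B := by
  classical
  set W := Finset.univ.filter fun j => (∃ p : ℕ, p.Prime ∧ P₀ < p ∧ p ∣ lam j) ∧ ¬ Q' ∣ lam j
    with hW
  set A := D.biUnion fun q => Finset.univ.filter fun j => Q ∣ lam j ∧ ¬ q ∣ lam j with hA
  set A' := F.biUnion fun q => Finset.univ.filter fun j => q ∣ lam j ∧ ¬ Q' ∣ lam j with hA'
  have hWcard : (W.card : ℝ) ≤ B := by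
    rcases Finset.eq_empty_or_nonempty W with h | h
    · rw [h]; simpa using hB
    · obtain ⟨⟨p, hp, hpP, hpd⟩, -⟩ := (Finset.mem_filter.1 (W.min'_mem h)).2
      have hsub : W ⊆ Finset.univ.filter fun j => p ∣ lam j ∧ ¬ Q' ∣ lam j := by
        intro j hj
        refine Finset.mem_filter.2 ⟨Finset.mem_univ j, ?_, (Finset.mem_filter.1 hj).2.2⟩
        exact hpd.trans (hch _ _ (W.min'_le j hj))
      have h1 : (W.card : ℝ) ≤ max ((dvdCount lam p : ℝ) - dvdCount lam Q') 0 :=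
        (Nat.cast_le.2 (Finset.card_le_card hsub)).trans (card_dvd_not_dvd_le hch p Q')
      exact h1.trans (max_le (hlarge p hp hpP ⟨_, hpd⟩) hB)
  have hcover : (Finset.univ.filter fun j => Q ∣ lam j) ⊆
      (Finset.univ.filter fun j => lam j = d) ∪ (Finset.univ.filter fun j => Q' ∣ lam j)
        ∪ A ∪ A' ∪ W := by
    intro j hj
    rw [Finset.mem_filter] at hj
    by_contra hnot
    simp only [Finset.mem_union, not_or, hA, hA', hW, Finset.mem_biUnion, Finset.mem_filter,
      Finset.mem_univ, true_and, not_exists, not_and, not_not] at hnot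
    obtain ⟨⟨⟨⟨hne, hQ'⟩, h3⟩, h4⟩, h5⟩ := hnot
    refine hne (eq_of_primePow_dvd hd hD hF hj.2 hQ'
      (fun q hq => h3 q hq hj.2) (fun q hq hqd => hQ' (h4 q hq hqd)) fun p hp hpP hpd => ?_)
    exact hQ' (h5 ⟨p, hp, hpP, hpd⟩)
  have hAcard : (A.card : ℝ) ≤ ∑ q ∈ D, max ((dvdCount lam Q : ℝ) - dvdCount lam q) 0 := by
    refine le_trans (Nat.cast_le.2 Finset.card_biUnion_le) ?_
    push_cast
    exact Finset.sum_le_sum fun q _ => card_dvd_not_dvd_le hch Q q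
  have hAcard' : (A'.card : ℝ) ≤ ∑ q ∈ F, max ((dvdCount lam q : ℝ) - dvdCount lam Q') 0 := by
    refine le_trans (Nat.cast_le.2 Finset.card_biUnion_le) ?_
    push_cast
    exact Finset.sum_le_sum fun q _ => card_dvd_not_dvd_le hch q Q'
  have hle : (dvdCount lam Q : ℝ) ≤ (Finset.univ.filter fun j => lam j = d).card
      + dvdCount lam Q' + A.card + A'.card + W.card := by
    have h1 := Finset.card_le_card hcover
    have h2 := Finset.card_union_le ((Finset.univ.filter fun j => lam j = d) ∪
      (Finset.univ.filter fun j => Q' ∣ lam j) ∪ A ∪ A') W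
    have h3 := Finset.card_union_le ((Finset.univ.filter fun j => lam j = d) ∪
      (Finset.univ.filter fun j => Q' ∣ lam j) ∪ A) A'
    have h4 := Finset.card_union_le ((Finset.univ.filter fun j => lam j = d) ∪
      (Finset.univ.filter fun j => Q' ∣ lam j)) A
    have h5 := Finset.card_union_le (Finset.univ.filter fun j => lam j = d)
      (Finset.univ.filter fun j => Q' ∣ lam j)
    unfold dvdCount
    exact_mod_cast (by omega)
  linarith

end Chain

/-- The positive part of `ω(m;a,1) + 2 - ω(m;b,1)`. -/
def omegaGap (a b m : ℕ) : ℝ := max ((omegaQ m a : ℝ) + 2 - omegaQ m b) 0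

lemma omegaGap_le (a b m : ℕ) (x : ℝ) :
    omegaGap a b m ≤ max ((omegaQ m a : ℝ) + 2 - x) 0 + max (x - (omegaQ m b : ℝ)) 0 := by
  refine max_le ?_ (add_nonneg (le_max_right _ _) (le_max_right _ _))
  linarith [le_max_left ((omegaQ m a : ℝ) + 2 - x) 0, le_max_left (x - (omegaQ m b : ℝ)) 0]

lemma mean_omegaGap_bounded {a b : ℕ} (hb : 0 < b) (h : b.totient < a.totient) :
    ∃ C, ∀ n, 3 ≤ n → mean (omegaGap a b) n ≤ C := by
  have ha : 0 < a := by
    refine Nat.pos_of_ne_zero ?_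
    rintro rfl
    simp at h
  have hb' : (0 : ℝ) < b.totient := by exact_mod_cast Nat.totient_pos.2 hb
  have hlt : ((a.totient : ℝ))⁻¹ < (b.totient : ℝ)⁻¹ := by
    gcongr
  obtain ⟨c, hc1, hc2⟩ := exists_between hlt
  obtain ⟨C₁, h₁⟩ := mean_omegaQ_excess_bounded ha hc1
  obtain ⟨C₂, h₂⟩ := mean_omegaQ_deficit_bounded hb hc2
  refine ⟨C₁ + C₂, fun n hn => ?_⟩
  refine (mean_mono fun m _ _ => omegaGap_le a b m (c * LL n)).trans ?_
  rw [mean_add]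
  exact add_le_add (h₁ n hn) (h₂ n hn)

lemma mean_sum_omegaGap_bounded (s : Finset ℕ) (a b : ℕ → ℕ) (hb : ∀ q ∈ s, 0 < b q)
    (h : ∀ q ∈ s, (b q).totient < (a q).totient) :
    ∃ C, ∀ n, 3 ≤ n → mean (fun m => ∑ q ∈ s, omegaGap (a q) (b q) m) n ≤ C := by
  have hex : ∀ q, ∃ C, q ∈ s → ∀ n, 3 ≤ n → mean (omegaGap (a q) (b q)) n ≤ C := by
    intro q
    by_cases hq : q ∈ s
    · obtain ⟨C, hC⟩ := mean_omegaGap_bounded (hb q hq) (h q hq)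
      exact ⟨C, fun _ => hC⟩
    · exact ⟨0, fun h => absurd h hq⟩
  choose C hC using hex
  refine ⟨∑ q ∈ s, C q, fun n hn => ?_⟩
  rw [mean_sum]
  exact Finset.sum_le_sum fun q hq => hC q hq n hn

lemma exists_unitGroup_factors {m : ℕ} (hm : 1 ≤ m) :
    ∃ (K : ℕ) (lam : Fin K → ℕ), (∀ j, 1 < lam j) ∧ (∀ j k, j ≤ k → lam j ∣ lam k) ∧
      Nonempty ((ZMod m)ˣ ≃* Multiplicative (∀ j, ZMod (lam j))) ∧
      (∀ q, IsPrimePow q → omegaQ m q ≤ dvdCount lam q ∧ dvdCount lam q ≤ omegaQ m q + 2) ∧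
      ∀ j, lam j ≤ m := by
  have : NeZero m := ⟨by omega⟩
  obtain ⟨K, lam, h1, h2, ⟨e⟩⟩ := exists_invariant_factors (ZMod m)ˣ
  refine ⟨K, lam, h1, h2, ⟨e⟩, fun q hq => omegaQ_le_card_dvd_le hm h1 e hq, fun j => ?_⟩
  have hcard : m.totient = ∏ j, lam j := by
    rw [← ZMod.card_units_eq_totient, ← Nat.card_eq_fintype_card,
      Nat.card_congr (e.toEquiv.trans Multiplicative.toAdd), Nat.card_pi]
    simp only [Nat.card_zmod]
  have hdvd : lam j ∣ m.totient := hcard ▸ Finset.dvd_prod_of_mem lam (Finset.mem_univ j)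
  exact (Nat.le_of_dvd (Nat.totient_pos.2 hm) hdvd).trans (Nat.totient_le m)

lemma IsInvCount.le {d Q Q' : ℕ} {J : ℕ → ℕ} (hJ : IsInvCount d J) (hQ : IsPrimePow Q)
    (hQ' : IsPrimePow Q') (hd : Q ∣ d) (hd' : ¬ Q' ∣ d) {m : ℕ} (hm : 1 ≤ m) :
    (J m : ℝ) ≤ omegaQ m Q - omegaQ m Q' + 2 + omegaGap Q' Q m := by
  obtain ⟨K, lam, h1, h2, he, hω, -⟩ := exists_unitGroup_factors hm
  rw [hJ m hm K lam h1 h2 he]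
  refine (card_eq_le h2 hd hd').trans (max_le ?_ ?_)
  · have hle : (dvdCount lam Q : ℝ) ≤ omegaQ m Q + 2 := by exact_mod_cast (hω Q hQ).2
    have hge : (omegaQ m Q' : ℝ) ≤ dvdCount lam Q' := by exact_mod_cast (hω Q' hQ').1
    have : 0 ≤ omegaGap Q' Q m := le_max_right _ _
    linarith
  · have : (omegaQ m Q' : ℝ) + 2 - omegaQ m Q ≤ omegaGap Q' Q m := le_max_left _ _
    linarith

lemma IsInvCount.ge {d Q Q' P₀ : ℕ} {J : ℕ → ℕ} (hJ : IsInvCount d J) (hQ : IsPrimePow Q)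
    (hQ' : IsPrimePow Q') (hd : d ≠ 0) {D F : Finset ℕ}
    (hD : ∀ q, IsPrimePow q → q ∣ d → q ≠ Q → q ∈ D)
    (hF : ∀ q, IsPrimePow q → ¬ q ∣ d → q ≠ Q' → q ≤ d * P₀ → q ∈ F)
    (hDpp : ∀ q ∈ D, IsPrimePow q) (hFpp : ∀ q ∈ F, IsPrimePow q)
    {m n : ℕ} (hm : 1 ≤ m) (hmn : m ≤ n) (x : ℝ) :
    (omegaQ m Q : ℝ) - omegaQ m Q' - 2 ≤ J m + ∑ q ∈ D, omegaGap Q q m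
      + ∑ q ∈ F, omegaGap q Q' m
      + ∑ p ∈ (Finset.range (n + 1)).filter (fun p => p.Prime ∧ P₀ < p),
          max ((omegaQ m p : ℝ) + 2 - x) 0
      + max (x - (omegaQ m Q' : ℝ)) 0 := by
  obtain ⟨K, lam, h1, h2, he, hω, hlam⟩ := exists_unitGroup_factors hm
  have hω₁ : ∀ q, IsPrimePow q → (omegaQ m q : ℝ) ≤ dvdCount lam q := fun q hq => by
    exact_mod_cast (hω q hq).1
  have hω₂ : ∀ q, IsPrimePow q → (dvdCount lam q : ℝ) ≤ omegaQ m q + 2 := fun q hq => by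
    exact_mod_cast (hω q hq).2
  have hgap : ∀ a b, IsPrimePow a → IsPrimePow b →
      max ((dvdCount lam a : ℝ) - dvdCount lam b) 0 ≤ omegaGap a b m := fun a b ha hb =>
    max_le_max (sub_le_sub (hω₂ a ha) (hω₁ b hb)) le_rfl
  set S := ∑ p ∈ (Finset.range (n + 1)).filter (fun p => p.Prime ∧ P₀ < p),
    max ((omegaQ m p : ℝ) + 2 - x) 0 with hS
  have hS0 : 0 ≤ S := Finset.sum_nonneg fun _ _ => le_max_right _ _
  have hlarge : ∀ p : ℕ, p.Prime → P₀ < p → (∃ j, p ∣ lam j) →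
      (dvdCount lam p : ℝ) - dvdCount lam Q' ≤ S + max (x - (omegaQ m Q' : ℝ)) 0 := by
    rintro p hp hpP ⟨j, hj⟩
    have hpn : p ≤ n :=
      (Nat.le_of_dvd (one_pos.trans (h1 j)) hj).trans ((hlam j).trans hmn)
    have hmem : p ∈ (Finset.range (n + 1)).filter (fun p => p.Prime ∧ P₀ < p) :=
      Finset.mem_filter.2 ⟨Finset.mem_range.2 (by omega), hp, hpP⟩
    have hterm : max ((omegaQ m p : ℝ) + 2 - x) 0 ≤ S :=
      Finset.single_le_sum (f := fun p => max ((omegaQ m p : ℝ) + 2 - x) 0)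
        (fun _ _ => le_max_right _ _) hmem
    linarith [le_max_left ((omegaQ m p : ℝ) + 2 - x) 0, le_max_left (x - (omegaQ m Q' : ℝ)) 0,
      hω₂ p hp.isPrimePow, hω₁ Q' hQ']
  have key := dvdCount_le_card_eq_add h2 hd hD hF
    (add_nonneg hS0 (le_max_right (x - (omegaQ m Q' : ℝ)) 0)) hlarge
  have hsumD : ∑ q ∈ D, max ((dvdCount lam Q : ℝ) - dvdCount lam q) 0
      ≤ ∑ q ∈ D, omegaGap Q q m := Finset.sum_le_sum fun q hq => hgap Q q hQ (hDpp q hq)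
  have hsumF : ∑ q ∈ F, max ((dvdCount lam q : ℝ) - dvdCount lam Q') 0
      ≤ ∑ q ∈ F, omegaGap q Q' m := Finset.sum_le_sum fun q hq => hgap q Q' (hFpp q hq) hQ'
  rw [hJ m hm K lam h1 h2 he]
  linarith [hω₁ Q hQ, hω₂ Q' hQ']

lemma mean_omegaQ_sub_loglog_bounded {q : ℕ} (hq : 0 < q) :
    ∃ C, ∀ n, 3 ≤ n → |mean (fun m => omegaQ m q) n - (q.totient : ℝ)⁻¹ * LL n| ≤ C := by
  obtain ⟨C, hC⟩ := recipSum_sub_loglog_bounded q hq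
  refine ⟨C + 1, fun n hn => ?_⟩
  have h := abs_le.1 (hC n hn)
  rw [abs_le]
  constructor <;> linarith [h.1, h.2, mean_omegaQ_le q n, le_mean_omegaQ q (n := n) (by omega)]

theorem statement3 (i : ℕ) (hi : 2 ≤ i)
    (h1 : (UFO (i - 1)).ncard = 1) (h2 : (UFO i).ncard = 1) (h3 : (UFO (i + 1)).ncard = 1)
    (d : ℕ) (hd : UFO i = {d}) (J : ℕ → ℕ) (hJ : IsInvCount d J) :
    ∃ C : ℝ, ∀ n : ℕ, 3 ≤ n → |avg J n - muSeq i * LL n| ≤ C := by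
  classical
  obtain ⟨hd0, hQd, hQd', hlt, hsmall, hbig⟩ := totient_qt_extremal hi h1 h2 h3 hd
  have hQ := (qt_spec i).1
  have hQ' := (qt_spec (i + 1)).1
  have hmu : muSeq i = ((qt i).totient : ℝ)⁻¹ - ((qt (i + 1)).totient : ℝ)⁻¹ := by
    simp only [muSeq, phiQ, one_div]
  set Q := qt i
  set Q' := qt (i + 1)
  obtain ⟨c, hc0, hc⟩ := exists_between
    (inv_pos.2 (Nat.cast_pos.2 (Nat.totient_pos.2 hQ'.pos)) : (0 : ℝ) < (Q'.totient : ℝ)⁻¹)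
  obtain ⟨P₀, C₁, hC₁⟩ := mean_large_primes_excess_bounded hc0
  obtain ⟨C₂, hC₂⟩ := mean_omegaQ_deficit_bounded hQ'.pos hc
  set D := d.divisors.filter fun q => IsPrimePow q ∧ q ≠ Q with hDdef
  set F := (Finset.range (d * P₀ + 1)).filter fun q => IsPrimePow q ∧ ¬ q ∣ d ∧ q ≠ Q' with hFdef
  have hD : ∀ q ∈ D, q ∣ d ∧ IsPrimePow q ∧ q ≠ Q := fun q hq =>
    ⟨Nat.dvd_of_mem_divisors (Finset.mem_filter.1 hq).1, (Finset.mem_filter.1 hq).2⟩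
  have hF : ∀ q ∈ F, IsPrimePow q ∧ ¬ q ∣ d ∧ q ≠ Q' := fun q hq => (Finset.mem_filter.1 hq).2
  obtain ⟨C₃, hC₃⟩ := mean_sum_omegaGap_bounded D (fun _ => Q) (fun q => q)
    (fun q hq => (hD q hq).2.1.pos) fun q hq =>
      hsmall q (hD q hq).2.1 (hD q hq).1 (hD q hq).2.2
  obtain ⟨C₄, hC₄⟩ := mean_sum_omegaGap_bounded F (fun q => q) (fun _ => Q')
    (fun _ _ => hQ'.pos) fun q hq => hbig q (hF q hq).1 (hF q hq).2.1 (hF q hq).2.2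
  obtain ⟨C₅, hC₅⟩ := mean_omegaGap_bounded hQ.pos hlt
  obtain ⟨C₆, hC₆⟩ := mean_omegaQ_sub_loglog_bounded hQ.pos
  obtain ⟨C₇, hC₇⟩ := mean_omegaQ_sub_loglog_bounded hQ'.pos
  refine ⟨max (C₆ + C₇ + 2 + C₅) (C₆ + C₇ + 2 + C₃ + C₄ + C₁ + C₂), fun n hn => ?_⟩
  have havg : avg J n = mean (fun m => (J m : ℝ)) n := rfl
  have hup : mean (fun m => (J m : ℝ)) n ≤
      mean (fun m => (omegaQ m Q : ℝ) - omegaQ m Q' + 2 + omegaGap Q' Q m) n :=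
    mean_mono fun m hm _ => hJ.le hQ hQ' hQd hQd' hm
  have hlow : mean (fun m => (omegaQ m Q : ℝ) - omegaQ m Q' - 2) n ≤ _ :=
    mean_mono fun m hm hmn => hJ.ge (P₀ := P₀) (D := D) (F := F) hQ hQ' hd0
      (fun q hq hqd hne => Finset.mem_filter.2 ⟨Nat.mem_divisors.2 ⟨hqd, hd0⟩, hq, hne⟩)
      (fun q hq hqd hne hle =>
        Finset.mem_filter.2 ⟨Finset.mem_range.2 (Nat.lt_succ_of_le hle), hq, hqd, hne⟩)
      (fun q hq => (hD q hq).2.1) (fun q hq => (hF q hq).1) hm hmn (c * LL n)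
  simp only [mean_add, mean_sub, mean_const _ (show 0 < n by omega)] at hup hlow
  have b₁ := hC₁ n hn
  have b₂ := hC₂ n hn
  have b₃ := hC₃ n hn
  have b₄ := hC₄ n hn
  have b₅ := hC₅ n hn
  have b₆ := abs_le.1 (hC₆ n hn)
  have b₇ := abs_le.1 (hC₇ n hn)
  have b₅' : mean (fun m => omegaGap Q' Q m) n ≤ C₅ := b₅
  rw [havg, hmu, sub_mul, abs_le]
  constructor
  · linarith [le_max_right (C₆ + C₇ + 2 + C₅) (C₆ + C₇ + 2 + C₃ + C₄ + C₁ + C₂), b₆.1, b₇.2]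
  · linarith [le_max_left (C₆ + C₇ + 2 + C₅) (C₆ + C₇ + 2 + C₃ + C₄ + C₁ + C₂), b₆.2, b₇.1]

end
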